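/- arXiv:1807.03358 — 17 statements merged into one kernel-verified Lean document; each statement's English description precedes it below -/
import Mathlib

section
/- Let ξ ≥ 0 with ξ ≠ 2, and let f : (−∞,0) → ℝ be a background solution. Then the limit of (−τ)·f(τ) as τ → 0⁻ exists and equals c·ξ for some c ∈ {0, c₁, c₂}, where c₁ = (1 − √(1 − 4/ξ²))/2 and c₂ = (1 + √(1 − 4/ξ²))/2 (these two values occurring only when ξ > 2; for 0 ≤ ξ < 2 the limit is necessarily 0). -/
open Filter

/-- A Barbalat-type lemma: if `F` converges at infinity and has a bounded second derivative,
then its derivative tends to zero. -/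
theorem tendsto_deriv_zero_of_bounded_second_deriv {F φ ψ : ℝ → ℝ} {A K : ℝ}
    (hF : ∀ s, HasDerivAt F (φ s) s) (hφ : ∀ s, HasDerivAt φ (ψ s) s)
    (hK : ∀ s, 0 ≤ s → |ψ s| ≤ K) (hA : Tendsto F atTop (nhds A)) :
    Tendsto φ atTop (nhds 0) := by
  have hK0 : 0 ≤ K := (abs_nonneg _).trans (hK 0 le_rfl)
  rw [Metric.tendsto_nhds]
  intro ε hε
  obtain ⟨δ, hδ, hKδ⟩ : ∃ δ : ℝ, 0 < δ ∧ K * δ < ε / 2 := by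
    refine ⟨ε / (2 * (K + 1)), by positivity, ?_⟩
    rw [← mul_div_assoc, div_lt_div_iff₀ (by positivity) (by norm_num)]
    nlinarith
  have hdiff : Tendsto (fun s => F (s + δ) - F s) atTop (nhds 0) := by
    simpa using (hA.comp (tendsto_atTop_add_const_right atTop δ tendsto_id)).sub hA
  have hsmall := (Metric.tendsto_nhds.1 hdiff) (δ * (ε / 2)) (by positivity)
  filter_upwards [hsmall, eventually_ge_atTop 0] with s hs hs0
  rw [Real.dist_eq, sub_zero] at hs ⊢
  obtain ⟨t, ht, hφt⟩ := exists_hasDerivAt_eq_slope F φ (lt_add_of_pos_right s hδ)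
    (fun x _ => (hF x).continuousAt.continuousWithinAt) (fun x _ => hF x)
  have h1 : |φ t| < ε / 2 := by
    rw [hφt, add_sub_cancel_left, abs_div, abs_of_pos hδ, div_lt_iff₀ hδ]
    linarith
  obtain ⟨u, hu, hψu⟩ := exists_hasDerivAt_eq_slope φ ψ ht.1
    (fun x _ => (hφ x).continuousAt.continuousWithinAt) (fun x _ => hφ x)
  have hts : 0 < t - s := sub_pos.2 ht.1
  have h2 : |φ t - φ s| < ε / 2 := by
    rw [eq_div_iff hts.ne'] at hψu
    rw [← hψu, abs_mul, abs_of_pos hts]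
    have := hK u (hs0.trans hu.1.le)
    have : |ψ u| * (t - s) ≤ K * δ := by
      gcongr
      linarith [ht.2]
    linarith
  rw [abs_lt] at h1 h2 ⊢
  constructor <;> linarith [h1.1, h1.2, h2.1, h2.2]

/-- If `u` is continuous and `p ∘ u` converges for a nonconstant polynomial `p`, then every
bounded such `u` converges. -/
theorem exists_tendsto_of_polynomial_eval_tendsto {u : ℝ → ℝ} {p : Polynomial ℝ} {A R : ℝ}
    (hu : Continuous u) (hp : ∀ a, p ≠ Polynomial.C a) (hR : ∀ s, 0 ≤ s → |u s| ≤ R)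
    (hA : Tendsto (fun s => p.eval (u s)) atTop (nhds A)) :
    ∃ L, Tendsto u atTop (nhds L) := by
  refine tendsto_of_no_upcrossings (s := Set.univ) dense_univ ?_ ?_ ?_
  · rintro a - b - hab ⟨ha, hb⟩
    have hroot : ∀ c ∈ Set.Ioo a b, (p - Polynomial.C A).IsRoot c := by
      intro c hc
      have hfreq : ∃ᶠ s in atTop, u s = c := by
        rw [frequently_atTop] at ha hb ⊢
        intro S
        obtain ⟨x, hx, hxa⟩ := ha S
        obtain ⟨y, hy, hyb⟩ := hb x
        obtain ⟨z, hz, hzc⟩ := intermediate_value_Icc hy hu.continuousOn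
          (⟨(hxa.trans hc.1).le, (hc.2.trans hyb).le⟩ : c ∈ Set.Icc (u x) (u y))
        exact ⟨z, le_trans hx hz.1, hzc⟩
      have hval : p.eval c = A := by
        by_contra hne
        have hev := hA.eventually_ne (Ne.symm hne)
        obtain ⟨s, hs, hs'⟩ := (hfreq.and_eventually hev).exists
        exact hs' (by rw [hs])
      simp [Polynomial.IsRoot, hval]
    have hfin : (Set.Ioo a b).Finite :=
      (Polynomial.finite_setOfPred_isRoot (sub_ne_zero.2 (hp A))).subset hroot
    exact Set.Ioo_infinite hab hfin
  · exact isBoundedUnder_of_eventually_le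
      ((eventually_ge_atTop 0).mono fun s hs => (abs_le.1 (hR s hs)).2)
  · exact isBoundedUnder_of_eventually_ge
      ((eventually_ge_atTop 0).mono fun s hs => (abs_le.1 (hR s hs)).1)

/-- Every solution of the damped oscillator `g'' + 3 g' + 2 g (1 - ξ g + g²) = 0` converges to a
critical point of its potential. -/
theorem damped_quartic_oscillator_tendsto {ξ : ℝ} {g h : ℝ → ℝ}
    (hg : ∀ s, HasDerivAt g (h s) s)
    (hh : ∀ s, HasDerivAt h (-3 * h s - (2 * g s - 2 * ξ * g s ^ 2 + 2 * g s ^ 3)) s) :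
    ∃ L, 2 * L - 2 * ξ * L ^ 2 + 2 * L ^ 3 = 0 ∧ Tendsto g atTop (nhds L) := by
  have hgc : Continuous g := continuous_iff_continuousAt.2 fun s => (hg s).continuousAt
  set V : ℝ → ℝ := fun x => x ^ 2 - 2 * ξ / 3 * x ^ 3 + x ^ 4 / 2 with hV
  set E : ℝ → ℝ := fun s => h s ^ 2 / 2 + V (g s) with hE
  have hVlow : ∀ x, x ^ 2 - ξ ^ 4 / 6 ≤ V x := by
    intro x
    have h1 : 0 ≤ (x - ξ) ^ 2 * (2 * x ^ 2 + (x + ξ) ^ 2) := by positivity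
    simp only [hV]
    nlinarith [h1]
  have hEderiv : ∀ s, HasDerivAt E (-3 * h s ^ 2) s := by
    intro s
    have := (((hh s).pow 2).div_const 2).add ((((hg s).pow 2).sub
      (((hg s).pow 3).const_mul (2 * ξ / 3))).add (((hg s).pow 4).div_const 2))
    refine this.congr_deriv ?_
    norm_num
    ring
  have hEanti : Antitone E := antitone_of_hasDerivAt_nonpos hEderiv
    fun s => by simpa using sq_nonneg (h s)
  have hElow : ∀ s, g s ^ 2 + h s ^ 2 / 2 - ξ ^ 4 / 6 ≤ E s := fun s => by
    have := hVlow (g s)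
    simp only [hE]
    linarith
  have hEbdd : BddBelow (Set.range E) := by
    refine ⟨-(ξ ^ 4 / 6), ?_⟩
    rintro _ ⟨s, rfl⟩
    nlinarith [hElow s, sq_nonneg (g s), sq_nonneg (h s)]
  have hElim := tendsto_atTop_ciInf hEanti hEbdd
  set R : ℝ := √(2 * (E 0 + ξ ^ 4 / 6))
  have hgR : ∀ s, 0 ≤ s → |g s| ≤ R := fun s hs => Real.abs_le_sqrt (by
    nlinarith [hElow s, hEanti hs, sq_nonneg (g s), sq_nonneg (h s)])
  have hhR : ∀ s, 0 ≤ s → |h s| ≤ R := fun s hs => Real.abs_le_sqrt (by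
    nlinarith [hElow s, hEanti hs, sq_nonneg (g s), sq_nonneg (h s)])
  have hbound : ∀ Φ : ℝ × ℝ → ℝ, Continuous Φ → ∃ K, ∀ s, 0 ≤ s → |Φ (g s, h s)| ≤ K := by
    intro Φ hΦ
    obtain ⟨K, hK⟩ := (isCompact_Icc.prod isCompact_Icc :
      IsCompact (Set.Icc (-R) R ×ˢ Set.Icc (-R) R)).exists_bound_of_continuousOn hΦ.continuousOn
    exact ⟨K, fun s hs => hK _ ⟨abs_le.1 (hgR s hs), abs_le.1 (hhR s hs)⟩⟩
  have hsq : Tendsto (fun s => -3 * h s ^ 2) atTop (nhds 0) := by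
    obtain ⟨K, hK⟩ := hbound (fun q => -3 * (2 * q.2 *
      (-3 * q.2 - (2 * q.1 - 2 * ξ * q.1 ^ 2 + 2 * q.1 ^ 3)))) (by fun_prop)
    refine tendsto_deriv_zero_of_bounded_second_deriv hEderiv (fun s => ?_) hK hElim
    refine (((hh s).pow 2).const_mul (-3)).congr_deriv ?_
    norm_num
  have hh2 : Tendsto (fun s => h s ^ 2) atTop (nhds 0) := by
    have := hsq.const_mul (-1 / 3)
    rw [mul_zero] at this
    exact this.congr fun s => by ring
  have hh0 : Tendsto h atTop (nhds 0) := by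
    rw [tendsto_zero_iff_abs_tendsto_zero]
    have := hh2.sqrt
    simpa [Real.sqrt_sq_eq_abs, Function.comp_def] using this
  have hVlim : Tendsto (fun s => V (g s)) atTop (nhds (⨅ s, E s)) := by
    have := hElim.sub (hh2.div_const 2)
    rw [zero_div, sub_zero] at this
    exact this.congr fun s => by simp [hE]
  obtain ⟨L, hL⟩ : ∃ L, Tendsto g atTop (nhds L) := by
    refine exists_tendsto_of_polynomial_eval_tendsto
      (p := Polynomial.X ^ 2 - Polynomial.C (2 * ξ / 3) * Polynomial.X ^ 3
        + Polynomial.C (1 / 2) * Polynomial.X ^ 4) hgc ?_ hgR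
      (hVlim.congr fun s => by simp [hV]; ring)
    intro a ha
    have := congrArg (fun q => Polynomial.coeff q 4) ha
    simp [Polynomial.coeff_X_pow] at this
  refine ⟨L, ?_, hL⟩
  have hacc : Tendsto (fun s => -3 * h s - (2 * g s - 2 * ξ * g s ^ 2 + 2 * g s ^ 3))
      atTop (nhds 0) := by
    obtain ⟨K, hK⟩ := hbound (fun q => -3 *
      (-3 * q.2 - (2 * q.1 - 2 * ξ * q.1 ^ 2 + 2 * q.1 ^ 3))
      - (2 * q.2 - 2 * ξ * (2 * q.1 * q.2) + 2 * (3 * q.1 ^ 2 * q.2))) (by fun_prop)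
    refine tendsto_deriv_zero_of_bounded_second_deriv hh (fun s => ?_) hK hh0
    refine (((hh s).const_mul (-3)).sub ((((hg s).const_mul 2).sub
      (((hg s).pow 2).const_mul (2 * ξ))).add (((hg s).pow 3).const_mul 2))).congr_deriv ?_
    norm_num
  have hacc' := (hh0.const_mul (-3)).sub (((hL.const_mul 2).sub
    ((hL.pow 2).const_mul (2 * ξ))).add ((hL.pow 3).const_mul 2))
  linarith [tendsto_nhds_unique hacc hacc']

/-- The critical points of the potential are `0` and, for `2 < ξ`, the two rescaled roots. -/
theorem critical_point_cases {ξ L : ℝ} (hξ0 : 0 ≤ ξ) (hξ2 : ξ ≠ 2)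
    (hL : 2 * L - 2 * ξ * L ^ 2 + 2 * L ^ 3 = 0) :
    ∃ c : ℝ,
      (c = 0 ∨ (2 < ξ ∧
        (c = (1 - Real.sqrt (1 - 4 / ξ ^ 2)) / 2 ∨
         c = (1 + Real.sqrt (1 - 4 / ξ ^ 2)) / 2))) ∧ L = c * ξ := by
  have hfac : L * (1 - ξ * L + L ^ 2) = 0 := by linarith
  rcases mul_eq_zero.1 hfac with h0 | hq
  · exact ⟨0, Or.inl rfl, by simp [h0]⟩
  have hξ : 2 < ξ := by
    refine lt_of_le_of_ne ?_ hξ2.symm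
    nlinarith [sq_nonneg (2 * L - ξ)]
  have hpos : 0 < ξ := by linarith
  have hnn : 0 ≤ 1 - 4 / ξ ^ 2 := by
    rw [sub_nonneg, div_le_one (by positivity)]
    nlinarith
  have hsq : (2 * (L / ξ) - 1) ^ 2 = √(1 - 4 / ξ ^ 2) ^ 2 := by
    rw [Real.sq_sqrt hnn]
    field_simp
    linarith
  refine ⟨L / ξ, Or.inr ⟨hξ, ?_⟩, (div_mul_cancel₀ L hpos.ne').symm⟩
  rcases sq_eq_sq_iff_eq_or_eq_neg.1 hsq with h | h
  · right; linarith
  · left; linarith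

/-- Let `ξ ≥ 0` with `ξ ≠ 2`, and let `f : (−∞,0) → ℝ` be a background
solution of `f'' + 2 f³ − (2ξ/(−τ)) f² = 0`. Then the limit of `(−τ)·f(τ)` as `τ → 0⁻`
exists and equals `c·ξ` for some `c ∈ {0, c₁, c₂}`, where
`c₁ = (1 − √(1 − 4/ξ²))/2` and `c₂ = (1 + √(1 − 4/ξ²))/2`, the latter two values
occurring only when `ξ > 2`. -/
theorem background_future_limit
    (ξ : ℝ) (hξ0 : 0 ≤ ξ) (hξ2 : ξ ≠ 2)
    (f f' f'' : ℝ → ℝ)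
    (hf : ∀ τ < (0:ℝ), HasDerivAt f (f' τ) τ)
    (hf' : ∀ τ < (0:ℝ), HasDerivAt f' (f'' τ) τ)
    (hf''cont : ContinuousOn f'' (Set.Iio 0))
    (hode : ∀ τ < (0:ℝ), f'' τ + 2 * f τ ^ 3 - (2 * ξ / (-τ)) * f τ ^ 2 = 0) :
    ∃ c : ℝ,
      (c = 0 ∨ (2 < ξ ∧
        (c = (1 - Real.sqrt (1 - 4 / ξ ^ 2)) / 2 ∨
         c = (1 + Real.sqrt (1 - 4 / ξ ^ 2)) / 2))) ∧
      Tendsto (fun τ => (-τ) * f τ) (nhdsWithin 0 (Set.Iio 0)) (nhds (c * ξ)) := by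
  set T : ℝ → ℝ := fun s => -Real.exp (-s) with hT
  have hTneg : ∀ s, T s < 0 := fun s => neg_lt_zero.2 (Real.exp_pos _)
  have hTd : ∀ s, HasDerivAt T (-T s) s := fun s =>
    ((hasDerivAt_neg s).exp.neg).congr_deriv (by simp [hT])
  have hfT : ∀ s, HasDerivAt (fun s => f (T s)) (f' (T s) * -T s) s := fun s =>
    (hf (T s) (hTneg s)).comp s (hTd s)
  have hfT' : ∀ s, HasDerivAt (fun s => f' (T s)) (f'' (T s) * -T s) s := fun s =>
    (hf' (T s) (hTneg s)).comp s (hTd s)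
  obtain ⟨L, hLcrit, hL⟩ := damped_quartic_oscillator_tendsto (ξ := ξ)
    (g := fun s => -T s * f (T s)) (h := fun s => T s * f (T s) + T s ^ 2 * f' (T s))
    (fun s => (((hTd s).neg).mul (hfT s)).congr_deriv (by
      rw [Pi.neg_apply]
      ring))
    (fun s => by
      refine (((hTd s).mul (hfT s)).add (((hTd s).pow 2).mul (hfT' s))).congr_deriv ?_
      have hne : T s ≠ 0 := (hTneg s).ne
      have hs := hode (T s) (hTneg s)
      have hf2 : T s * f'' (T s) = -2 * T s * f (T s) ^ 3 - 2 * ξ * f (T s) ^ 2 := by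
        field_simp at hs
        linarith
      norm_num
      linear_combination (-T s ^ 2) * hf2)
  obtain ⟨c, hc, rfl⟩ := critical_point_cases hξ0 hξ2 hLcrit
  refine ⟨c, hc, ?_⟩
  have hneg : Tendsto (fun τ : ℝ => -τ) (nhdsWithin 0 (Set.Iio 0)) (nhdsWithin 0 (Set.Ioi 0)) := by
    simpa using tendsto_neg_nhdsLT (a := (0 : ℝ))
  have hlog : Tendsto (fun τ : ℝ => -Real.log (-τ)) (nhdsWithin 0 (Set.Iio 0)) atTop :=
    tendsto_neg_atBot_atTop.comp (Real.tendsto_log_nhdsGT_zero.comp hneg)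
  refine (hL.comp hlog).congr' ?_
  filter_upwards [self_mem_nhdsWithin] with τ hτ
  have hτT : T (-Real.log (-τ)) = τ := by
    simp only [hT, neg_neg]
    rw [Real.exp_log (neg_pos.2 hτ), neg_neg]
  simp only [Function.comp_apply, hτT]
end

section
/- Let ξ ≥ 0 and let f : (−∞,0) → ℝ be a background solution. Then the limit ω := lim_{τ→−∞} ω_f(τ) exists and is a nonnegative real number. Moreover ω > 0 provided there exists τ₁ < 0 such that either (i) 0 ≤ ξ < 2 and ω_f(τ₁) > 0, or (ii) ω_f(τ₁) > (4/3)·ξ/(−τ₁). -/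
open Filter

namespace ChromoNatural

theorem monotoneOn_Ici_of_hasDerivAt_nonneg {u u' : ℝ → ℝ} {a : ℝ}
    (hu : ∀ t, a ≤ t → HasDerivAt u (u' t) t) (h0 : ∀ t, a ≤ t → 0 ≤ u' t) :
    MonotoneOn u (Set.Ici a) := by
  refine monotoneOn_of_deriv_nonneg (convex_Ici a)
    (fun t ht => (hu t ht).continuousAt.continuousWithinAt) ?_ ?_
  · intro t ht
    rw [interior_Ici] at ht
    exact (hu t (le_of_lt ht)).differentiableAt.differentiableWithinAt
  · intro t ht
    rw [interior_Ici] at ht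
    rw [(hu t (le_of_lt ht)).deriv]
    exact h0 t (le_of_lt ht)

/-- The energy `h² + g⁴`, where `h` stands for the derivative of `g`. -/
def energy (g h : ℝ → ℝ) (t : ℝ) : ℝ := h t ^ 2 + g t ^ 4

/-- The energy corrected by the cubic potential term with coefficient `a / t`. -/
noncomputable def correctedEnergy (a : ℝ) (g h : ℝ → ℝ) (t : ℝ) : ℝ :=
  h t ^ 2 + g t ^ 4 - a / t * g t ^ 3

theorem energy_nonneg (g h : ℝ → ℝ) (t : ℝ) : 0 ≤ energy g h t := by
  unfold energy; positivity

/-- The background equation in the reversed time `t = -τ`, as a first-order system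
with `a = 4ξ/3`. -/
structure IsReversedSolution (a : ℝ) (g h : ℝ → ℝ) : Prop where
  deriv_fst : ∀ t, 0 < t → HasDerivAt g (h t) t
  deriv_snd : ∀ t, 0 < t → HasDerivAt h (3 * a / (2 * t) * g t ^ 2 - 2 * g t ^ 3) t

variable {a : ℝ} {g h : ℝ → ℝ}

theorem IsReversedSolution.hasDerivAt_energy (S : IsReversedSolution a g h) {t : ℝ}
    (ht : 0 < t) : HasDerivAt (energy g h) (3 * a / t * (g t ^ 2 * h t)) t := by
  have := ((S.deriv_snd t ht).pow 2).add ((S.deriv_fst t ht).pow 4)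
  refine this.congr_deriv ?_
  have := ht.ne'
  push_cast
  field_simp
  ring

theorem IsReversedSolution.hasDerivAt_correctedEnergy (S : IsReversedSolution a g h) {t : ℝ}
    (ht : 0 < t) : HasDerivAt (correctedEnergy a g h) (a / t ^ 2 * g t ^ 3) t := by
  have h1 : HasDerivAt (fun s : ℝ => a / s) (-a / t ^ 2) t := by
    have := (hasDerivAt_const t a).div (hasDerivAt_id t) ht.ne'
    refine this.congr_deriv ?_
    simp
  have := (S.hasDerivAt_energy ht).sub (h1.mul ((S.deriv_fst t ht).pow 3))
  refine this.congr_deriv ?_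
  have := ht.ne'
  push_cast
  simp only [Pi.pow_apply]
  field_simp
  ring

theorem hasDerivAt_exp_div (b : ℝ) {t : ℝ} (ht : 0 < t) :
    HasDerivAt (fun s : ℝ => Real.exp (b / s)) (Real.exp (b / t) * (-b / t ^ 2)) t := by
  have := (hasDerivAt_const t b).div (hasDerivAt_id t) ht.ne'
  refine this.exp.congr_deriv ?_
  simp

theorem tendsto_exp_div (b : ℝ) :
    Tendsto (fun s : ℝ => Real.exp (b / s)) atTop (nhds 1) := by
  have : Tendsto (fun s : ℝ => b / s) atTop (nhds 0) := tendsto_const_nhds.div_atTop tendsto_id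
  simpa [Function.comp_def] using (Real.continuous_exp.tendsto 0).comp this

theorem abs_mul_cube_le (ha : 0 ≤ a) (x : ℝ) : a * |x| ^ 3 ≤ x ^ 4 / 2 + 8 * a ^ 4 := by
  have hx : x ^ 4 = |x| ^ 4 := by rw [← abs_pow, abs_of_nonneg (by positivity)]
  rw [hx]
  have h0 := abs_nonneg x
  rcases le_total (2 * a) |x| with h1 | h1
  · have : 2 * a * |x| ^ 3 ≤ |x| * |x| ^ 3 := by gcongr
    nlinarith [pow_nonneg ha 4]
  · have : a * |x| ^ 3 ≤ a * (2 * a) ^ 3 := by gcongr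
    nlinarith [pow_nonneg h0 4]

theorem abs_cube_le {s : ℝ} (hs : 0 < s) (x : ℝ) : |x| ^ 3 ≤ s ^ 3 + x ^ 4 / s := by
  have hx : x ^ 4 = |x| ^ 4 := by rw [← abs_pow, abs_of_nonneg (by positivity)]
  rw [hx]
  have h0 := abs_nonneg x
  rcases le_total s |x| with h1 | h1
  · have : |x| ^ 3 ≤ |x| ^ 4 / s := by
      rw [le_div_iff₀ hs, pow_succ |x| 3]
      gcongr
    have := pow_pos hs 3
    linarith
  · have : |x| ^ 3 ≤ s ^ 3 := by gcongr
    have : 0 ≤ |x| ^ 4 / s := by positivity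
    linarith

theorem div_mul_cube_le (ha : 0 ≤ a) {t : ℝ} (ht : 1 ≤ t) (x : ℝ) :
    a / t * x ^ 3 ≤ x ^ 4 / 2 + 8 * a ^ 4 := by
  refine le_trans ?_ (abs_mul_cube_le ha x)
  have h1 : a / t ≤ a := div_le_self ha ht
  have h2 : x ^ 3 ≤ |x| ^ 3 := by rw [← abs_pow]; exact le_abs_self _
  have h3 : 0 ≤ a / t := by positivity
  calc a / t * x ^ 3 ≤ a / t * |x| ^ 3 := by gcongr
    _ ≤ a * |x| ^ 3 := by gcongr

theorem quartic_le_correctedEnergy (ha : 0 ≤ a) {t : ℝ} (ht : 1 ≤ t) :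
    g t ^ 4 / 2 ≤ correctedEnergy a g h t + 8 * a ^ 4 := by
  have := div_mul_cube_le ha ht (g t)
  unfold correctedEnergy
  nlinarith [sq_nonneg (h t)]

theorem IsReversedSolution.exists_tendsto_correctedEnergy (S : IsReversedSolution a g h)
    (ha : 0 ≤ a) : ∃ L, Tendsto (correctedEnergy a g h) atTop (nhds L) := by
  set K := 16 * a ^ 4 with hK
  have hG : ∀ t, 1 ≤ t → 0 ≤ correctedEnergy a g h t + K := fun t ht => by
    have := quartic_le_correctedEnergy (g := g) (h := h) ha ht
    have : 0 ≤ g t ^ 4 := by positivity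
    have : 0 ≤ a ^ 4 := by positivity
    linarith
  have hmono : MonotoneOn (fun t => -((correctedEnergy a g h t + K) * Real.exp (1 / t)))
      (Set.Ici 1) := by
    refine monotoneOn_Ici_of_hasDerivAt_nonneg (fun t ht =>
      (((S.hasDerivAt_correctedEnergy (by linarith)).add_const K).mul
        (hasDerivAt_exp_div 1 (by linarith))).neg) ?_
    intro t ht
    have h1 := quartic_le_correctedEnergy (g := g) (h := h) ha ht
    have h2 := abs_mul_cube_le ha (g t)
    have h3 : a * g t ^ 3 ≤ a * |g t| ^ 3 := by
      rw [← abs_pow]; exact mul_le_mul_of_nonneg_left (le_abs_self _) ha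
    have h4 : 0 ≤ correctedEnergy a g h t + K - a * g t ^ 3 := by linarith
    have h5 := mul_nonneg (div_nonneg h4 (sq_nonneg t)) (Real.exp_pos (1 / t)).le
    refine h5.trans (le_of_eq ?_)
    ring
  have hanti : Antitone
      (fun t => (correctedEnergy a g h (max t 1) + K) * Real.exp (1 / (max t 1))) := by
    intro x y hxy
    have := hmono (Set.mem_Ici.2 (le_max_right x 1)) (Set.mem_Ici.2 (le_max_right y 1))
      (max_le_max_right 1 hxy)
    simpa using this
  have hbdd : BddBelow (Set.range
      (fun t => (correctedEnergy a g h (max t 1) + K) * Real.exp (1 / (max t 1)))) := by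
    refine ⟨0, ?_⟩
    rintro _ ⟨t, rfl⟩
    exact mul_nonneg (hG _ (le_max_right t 1)) (Real.exp_pos _).le
  have hlim := (tendsto_atTop_ciInf hanti hbdd).div (tendsto_exp_div 1) one_ne_zero
  refine ⟨_, (hlim.sub_const K).congr' ?_⟩
  filter_upwards [eventually_ge_atTop 1] with t ht
  have := (Real.exp_pos (1 / t)).ne'
  simp only [Pi.div_apply, max_eq_left ht]
  field_simp
  ring

theorem tendsto_energy (ha : 0 ≤ a) {L : ℝ}
    (hL : Tendsto (correctedEnergy a g h) atTop (nhds L)) :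
    Tendsto (energy g h) atTop (nhds L) := by
  have hzero : Tendsto (fun t => a / t * g t ^ 3) atTop (nhds 0) := by
    have hbound : Tendsto (fun t => (correctedEnergy a g h t + 16 * a ^ 4) / t)
        atTop (nhds 0) := (hL.add_const _).div_atTop tendsto_id
    refine squeeze_zero_norm' ?_ hbound
    filter_upwards [eventually_ge_atTop 1] with t ht
    have ht0 : 0 < t := by linarith
    have h1 := quartic_le_correctedEnergy (g := g) (h := h) ha ht
    have h2 := abs_mul_cube_le ha (g t)
    rw [Real.norm_eq_abs, abs_mul, abs_div, abs_of_nonneg ha, abs_of_pos ht0, abs_pow,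
      div_mul_eq_mul_div]
    gcongr
    linarith
  have := hL.add hzero
  rw [add_zero] at this
  refine this.congr fun t => ?_
  unfold energy correctedEnergy
  ring

theorem IsReversedSolution.monotoneOn_mul_correctedEnergy (S : IsReversedSolution a g h)
    {t₁ : ℝ} (ht₁ : 0 < t₁) :
    MonotoneOn (fun t => t * correctedEnergy a g h t) (Set.Ici t₁) := by
  refine monotoneOn_Ici_of_hasDerivAt_nonneg (fun t ht => (hasDerivAt_id t).mul
    (S.hasDerivAt_correctedEnergy (ht₁.trans_le ht))) fun t ht => ?_
  have ht0 : t ≠ 0 := (ht₁.trans_le ht).ne'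
  refine (energy_nonneg g h t).trans (le_of_eq ?_)
  unfold energy correctedEnergy
  simp only [id]
  field_simp
  ring

theorem IsReversedSolution.limit_pos (S : IsReversedSolution a g h) (ha : 0 ≤ a) {L t₁ : ℝ}
    (hL : Tendsto (correctedEnergy a g h) atTop (nhds L)) (ht₁ : 0 < t₁)
    (hpos : 0 < correctedEnergy a g h t₁) : 0 < L := by
  set c := t₁ * correctedEnergy a g h t₁ with hc
  have hcpos : 0 < c := mul_pos ht₁ hpos
  have hcle : ∀ t, t₁ ≤ t → c ≤ t * correctedEnergy a g h t := fun t ht =>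
    S.monotoneOn_mul_correctedEnergy ht₁ Set.self_mem_Ici ht ht
  obtain ⟨s, hs, hsc⟩ : ∃ s : ℝ, 0 < s ∧ a * s ^ 3 < c / 2 := by
    have h1 : Tendsto (fun s : ℝ => a * s ^ 3) (nhdsWithin 0 (Set.Ioi 0)) (nhds 0) := by
      have : Continuous fun s : ℝ => a * s ^ 3 := by fun_prop
      simpa using (this.tendsto 0).mono_left nhdsWithin_le_nhds
    obtain ⟨s, h2, h3⟩ :=
      ((h1.eventually_lt_const (half_pos hcpos)).and self_mem_nhdsWithin).exists
    exact ⟨s, h3, h2⟩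
  obtain ⟨T, hT₁, hT⟩ : ∃ T, t₁ ≤ T ∧ 2 * a / s ≤ T :=
    ⟨max t₁ (2 * a / s), le_max_left _ _, le_max_right _ _⟩
  have hT0 : 0 < T := ht₁.trans_le hT₁
  have hFpos : ∀ t, t₁ ≤ t → 0 < correctedEnergy a g h t := fun t ht =>
    pos_of_mul_pos_right (hcpos.trans_le (hcle t ht)) (ht₁.le.trans ht)
  have hmono : MonotoneOn
      (fun t => (correctedEnergy a g h t + s ^ 4) * Real.exp (-(a / s) / t)) (Set.Ici T) := by
    refine monotoneOn_Ici_of_hasDerivAt_nonneg (fun t ht =>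
      (((S.hasDerivAt_correctedEnergy (hT0.trans_le ht)).add_const (s ^ 4)).mul
        (hasDerivAt_exp_div (-(a / s)) (hT0.trans_le ht)))) ?_
    intro t ht
    have ht0 : 0 < t := hT0.trans_le ht
    have hF := hFpos t (hT₁.trans ht)
    have key : 0 ≤ g t ^ 3 + (correctedEnergy a g h t + s ^ 4) / s := by
      have hs4 : (correctedEnergy a g h t + s ^ 4) / s
          = correctedEnergy a g h t / s + s ^ 3 := by field_simp
      rw [hs4]
      rcases le_total 0 (g t) with hg | hg
      · positivity
      · have h1 := abs_cube_le hs (g t)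
        have h2 : g t ^ 4 ≤ correctedEnergy a g h t := by
          have : 0 ≤ a / t * (-g t) ^ 3 := by
            have : 0 ≤ -g t := by linarith
            positivity
          unfold correctedEnergy
          nlinarith [sq_nonneg (h t)]
        have h3 : g t ^ 4 / s ≤ correctedEnergy a g h t / s := by gcongr
        rw [abs_of_nonpos hg] at h1
        nlinarith
    have h5 : 0 ≤ a / t ^ 2 * (g t ^ 3 + (correctedEnergy a g h t + s ^ 4) / s)
        * Real.exp (-(a / s) / t) := by positivity
    refine h5.trans (le_of_eq ?_)
    ring
  have hlim : Tendsto (fun t => (correctedEnergy a g h t + s ^ 4) * Real.exp (-(a / s) / t))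
      atTop (nhds (L + s ^ 4)) := by
    simpa using (hL.add_const (s ^ 4)).mul (tendsto_exp_div (-(a / s)))
  have hge : (correctedEnergy a g h T + s ^ 4) * Real.exp (-(a / s) / T) ≤ L + s ^ 4 := by
    refine ge_of_tendsto hlim ?_
    filter_upwards [eventually_ge_atTop T] with t ht
    exact hmono Set.self_mem_Ici ht ht
  have hexp : 1 - a / s / T ≤ Real.exp (-(a / s) / T) := by
    have := Real.add_one_le_exp (-(a / s) / T)
    rw [neg_div] at this ⊢
    linarith
  set F := correctedEnergy a g h T with hFdef
  have hF : 0 < F := hFpos T hT₁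
  have hF' : c ≤ T * F := hcle T hT₁
  have h1 : (F + s ^ 4) * (1 - a / s / T) ≤ L + s ^ 4 :=
    le_trans (by gcongr) hge
  have h2 : a / s / T ≤ 1 / 2 := by
    rw [div_le_iff₀ hT0]
    have : 2 * a / s = 2 * (a / s) := by ring
    linarith
  have h3 : s ^ 4 * (a / s / T) < F / 2 := by
    have : s ^ 4 * (a / s / T) = a * s ^ 3 / T := by field_simp
    rw [this, div_lt_iff₀ hT0]
    linarith
  have h4 : F * (a / s / T) ≤ F * (1 / 2) := by gcongr
  nlinarith

theorem IsReversedSolution.exists_correctedEnergy_pos (S : IsReversedSolution a g h)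
    (ha : 0 ≤ a) (ha' : 3 * a < 8) {t₁ : ℝ} (ht₁ : 0 < t₁) (hpos : 0 < energy g h t₁) :
    ∃ t, t₁ ≤ t ∧ 0 < correctedEnergy a g h t := by
  by_contra! hneg
  set p := 3 * a / 2 with hp
  have hmono : MonotoneOn (fun t => t ^ p * energy g h t) (Set.Ici t₁) := by
    refine monotoneOn_Ici_of_hasDerivAt_nonneg (fun t ht =>
      (Real.hasDerivAt_rpow_const (Or.inl (ht₁.trans_le ht).ne')).mul
      (S.hasDerivAt_energy (ht₁.trans_le ht))) fun t ht => ?_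
    have ht0 : 0 < t := ht₁.trans_le ht
    have h1 : 0 ≤ (h t + g t ^ 2) ^ 2 := sq_nonneg _
    have h2 : 0 ≤ p / t * t ^ p * (h t + g t ^ 2) ^ 2 := by positivity
    refine h2.trans (le_of_eq ?_)
    rw [Real.rpow_sub_one ht0.ne', hp]
    unfold energy
    field_simp
    ring
  have hupper : ∀ t, t₁ ≤ t → energy g h t ≤ (a / t) ^ 4 := by
    intro t ht
    have ht0 : 0 < t := ht₁.trans_le ht
    have h1 := hneg t ht
    have hE : energy g h t ≤ a / t * g t ^ 3 := by
      unfold correctedEnergy at h1; unfold energy; linarith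
    have hg4 : g t ^ 4 ≤ a / t * g t ^ 3 := by
      refine le_trans ?_ hE
      unfold energy
      nlinarith [sq_nonneg (h t)]
    have hat : 0 ≤ a / t := by positivity
    rcases le_or_gt (g t) 0 with hg | hg
    · have : 0 ≤ a / t * (-g t) ^ 3 := by
        have : 0 ≤ -g t := by linarith
        positivity
      have : 0 ≤ (a / t) ^ 4 := by positivity
      nlinarith
    · have hga : g t ≤ a / t := by
        refine le_of_mul_le_mul_right ?_ (pow_pos hg 3)
        linarith [show g t * g t ^ 3 = g t ^ 4 by ring]
      calc energy g h t ≤ a / t * g t ^ 3 := hE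
        _ ≤ a / t * (a / t) ^ 3 := by gcongr
        _ = (a / t) ^ 4 := by ring
  have hlim : Tendsto (fun t : ℝ => a ^ 4 * t ^ (-(4 - p))) atTop (nhds 0) := by
    simpa using (tendsto_rpow_neg_atTop (show 0 < 4 - p by linarith)).const_mul (a ^ 4)
  have hle : t₁ ^ p * energy g h t₁ ≤ 0 := by
    refine ge_of_tendsto hlim ?_
    filter_upwards [eventually_ge_atTop t₁] with t ht
    have ht0 : 0 < t := ht₁.trans_le ht
    have h1 : t₁ ^ p * energy g h t₁ ≤ t ^ p * energy g h t := hmono Set.self_mem_Ici ht ht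
    refine h1.trans ?_
    have h2 : t ^ p * energy g h t ≤ t ^ p * (a / t) ^ 4 := by
      gcongr; exact hupper t ht
    refine h2.trans (le_of_eq ?_)
    rw [neg_sub, Real.rpow_sub ht0, div_pow]
    norm_cast
    ring
  exact absurd hle (not_le.2 (by positivity))

theorem correctedEnergy_pos_of_lt (ha : 0 ≤ a) {t : ℝ} (ht : 0 < t)
    (hlt : a / t < energy g h t ^ ((1 : ℝ) / 4)) : 0 < correctedEnergy a g h t := by
  set w := energy g h t ^ ((1 : ℝ) / 4) with hw
  have hat : 0 ≤ a / t := by positivity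
  have hw0 : 0 < w := hat.trans_lt hlt
  have hw4 : w ^ 4 = energy g h t := by
    rw [hw, ← Real.rpow_natCast, ← Real.rpow_mul (energy_nonneg g h t)]
    norm_num
  have hgw : g t ≤ w := by
    refine le_of_abs_le (abs_le_of_sq_le_sq ?_ hw0.le)
    refine (pow_le_pow_iff_left₀ (by positivity) (by positivity) two_ne_zero).1 ?_
    rw [← pow_mul, ← pow_mul, show w ^ (2 * 2) = energy g h t from hw4, energy]
    norm_num
    positivity
  have hg3 : g t ^ 3 ≤ w ^ 3 := (Odd.strictMono_pow (by decide)).monotone hgw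
  have h1 : a / t * g t ^ 3 ≤ a / t * w ^ 3 := by gcongr
  have h2 : a / t * w ^ 3 < w * w ^ 3 := by gcongr
  have h3 : w * w ^ 3 = h t ^ 2 + g t ^ 4 := by
    rw [show w * w ^ 3 = w ^ 4 by ring, hw4, energy]
  unfold correctedEnergy
  linarith

end ChromoNatural


/-- Let `ξ ≥ 0` and let `f` be a background solution of
`f'' + 2 f³ − (2ξ/(−τ)) f² = 0` on `(−∞,0)`. Then the limit
`ω := lim_{τ→−∞} ω_f(τ)` of `ω_f(τ) = (f'(τ)² + f(τ)⁴)^{1/4}` exists and is a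
nonnegative real number. Moreover `ω > 0` provided there exists `τ₁ < 0` such
that either (i) `0 ≤ ξ < 2` and `ω_f(τ₁) > 0`, or (ii) `ω_f(τ₁) > (4/3)·ξ/(−τ₁)`. -/
theorem background_omega_exists
    (ξ : ℝ) (hξ0 : 0 ≤ ξ)
    (f f' f'' : ℝ → ℝ)
    (hf : ∀ τ < (0:ℝ), HasDerivAt f (f' τ) τ)
    (hf' : ∀ τ < (0:ℝ), HasDerivAt f' (f'' τ) τ)
    (hf''cont : ContinuousOn f'' (Set.Iio 0))
    (hode : ∀ τ < (0:ℝ), f'' τ + 2 * f τ ^ 3 - (2 * ξ / (-τ)) * f τ ^ 2 = 0) :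
    ∃ ω : ℝ, 0 ≤ ω ∧
      Tendsto (fun τ => (f' τ ^ 2 + f τ ^ 4) ^ ((1:ℝ)/4)) atBot (nhds ω) ∧
      ((∃ τ₁ < (0:ℝ),
          (ξ < 2 ∧ 0 < (f' τ₁ ^ 2 + f τ₁ ^ 4) ^ ((1:ℝ)/4)) ∨
          (4/3) * ξ / (-τ₁) < (f' τ₁ ^ 2 + f τ₁ ^ 4) ^ ((1:ℝ)/4)) → 0 < ω) := by
  set g : ℝ → ℝ := fun t => f (-t) with hg
  set h : ℝ → ℝ := fun t => -f' (-t) with hh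
  have S : ChromoNatural.IsReversedSolution (4 / 3 * ξ) g h := by
    constructor
    · intro t ht
      have := (hf (-t) (by linarith)).comp t (hasDerivAt_neg t)
      exact this.congr_deriv (by simp [hh])
    · intro t ht
      have := ((hf' (-t) (by linarith)).comp t (hasDerivAt_neg t)).neg
      refine this.congr_deriv ?_
      have h1 := hode (-t) (by linarith)
      rw [neg_neg] at h1
      have h2 : 3 * (4 / 3 * ξ) / (2 * t) = 2 * ξ / t := by field_simp; ring
      simp only [hg, h2]
      linarith
  have ha : 0 ≤ 4 / 3 * ξ := by positivity
  have henergy : ∀ τ, ChromoNatural.energy g h (-τ) = f' τ ^ 2 + f τ ^ 4 := fun τ => by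
    simp [ChromoNatural.energy, hg, hh]
  obtain ⟨L, hL⟩ := S.exists_tendsto_correctedEnergy ha
  have hE := ChromoNatural.tendsto_energy ha hL
  refine ⟨L ^ ((1 : ℝ) / 4), ?_, ?_, ?_⟩
  · exact Real.rpow_nonneg
      (ge_of_tendsto' hE fun t => ChromoNatural.energy_nonneg g h t) _
  · have := (hE.comp tendsto_neg_atBot_atTop).rpow_const (p := (1 : ℝ) / 4)
      (Or.inr (by norm_num))
    refine this.congr fun τ => ?_
    rw [Function.comp_apply, henergy]
  · rintro ⟨τ₁, hτ₁, hcase⟩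
    refine Real.rpow_pos_of_pos ?_ _
    have ht₁ : 0 < -τ₁ := by linarith
    rw [← henergy τ₁] at hcase
    rcases hcase with ⟨hξ, hpos⟩ | hlt
    · have hpos' : 0 < ChromoNatural.energy g h (-τ₁) := by
        refine (ChromoNatural.energy_nonneg g h _).lt_of_ne fun h0 => ?_
        rw [← h0, Real.zero_rpow (by norm_num)] at hpos
        exact lt_irrefl _ hpos
      obtain ⟨t, ht, hFt⟩ := S.exists_correctedEnergy_pos ha (by linarith) ht₁ hpos'
      exact S.limit_pos ha hL (ht₁.trans_le ht) hFt
    · exact S.limit_pos ha hL ht₁ (ChromoNatural.correctedEnergy_pos_of_lt ha ht₁ hlt)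
end

section
/- For every real constant ξ, the planar system dq/dN = q − p, dp/dN = 2(q³ − ξ q² + p) has no nonconstant periodic trajectory: if a trajectory (q,p) : ℝ → ℝ² satisfies (q(N+T), p(N+T)) = (q(N), p(N)) for some T > 0 and all N ∈ ℝ, then (q,p) is constant. -/
open Filter

/-- A monotone periodic real function is constant. -/
theorem Monotone.eq_of_periodic {f : ℝ → ℝ} (hf : Monotone f) {T : ℝ} (hT : 0 < T)
    (hper : Function.Periodic f T) (x y : ℝ) : f x = f y := by
  have le (a b : ℝ) : f a ≤ f b := by
    obtain ⟨n, hn⟩ := Archimedean.arch (a - b) hT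
    rw [nsmul_eq_mul] at hn
    calc f a ≤ f (b + n * T) := hf (by linarith)
      _ = f b := hper.nat_mul n b
  exact le_antisymm (le x y) (le y x)

/-- The mechanical energy of the system, written as a second-order equation for `q` with
velocity `q - p`, grows at three times the squared velocity. -/
theorem hasDerivAt_energy {ξ : ℝ} {q p : ℝ → ℝ} {N : ℝ}
    (hq : HasDerivAt q (q N - p N) N)
    (hp : HasDerivAt p (2 * (q N ^ 3 - ξ * q N ^ 2 + p N)) N) :
    HasDerivAt (fun t ↦ (q t - p t) ^ 2 / 2 + (q t ^ 4 / 2 - 2 * ξ / 3 * q t ^ 3 + q t ^ 2))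
      (3 * (q N - p N) ^ 2) N := by
  refine ((((hq.fun_sub hp).fun_pow 2).div_const 2).fun_add
    ((((hq.fun_pow 4).div_const 2).fun_sub ((hq.fun_pow 3).const_mul (2 * ξ / 3))).fun_add
      (hq.fun_pow 2))).congr_deriv ?_
  push_cast
  ring

/-- **Bendixson's criterion.** For every real constant `ξ`, the planar
system `dq/dN = q − p`, `dp/dN = 2(q³ − ξ q² + p)` has no nonconstant periodic
trajectory: if a trajectory `(q,p) : ℝ → ℝ²` satisfies
`(q(N+T), p(N+T)) = (q(N), p(N))` for some `T > 0` and all `N ∈ ℝ`, then `(q,p)`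
is constant. -/
theorem no_periodic_trajectory
    (ξ : ℝ) (q p : ℝ → ℝ)
    (hq : ∀ N : ℝ, HasDerivAt q (q N - p N) N)
    (hp : ∀ N : ℝ, HasDerivAt p (2 * (q N ^ 3 - ξ * q N ^ 2 + p N)) N)
    (T : ℝ) (hT : 0 < T)
    (hper : ∀ N : ℝ, q (N + T) = q N ∧ p (N + T) = p N) :
    ∀ N M : ℝ, q N = q M ∧ p N = p M := by
  have henergy N := hasDerivAt_energy (hq N) (hp N)
  have hmono := monotone_of_hasDerivAt_nonneg henergy fun N ↦ by positivity
  have hconst := hmono.eq_of_periodic hT fun N ↦ by simp only [hper N]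
  have hqp (N : ℝ) : q N - p N = 0 := by
    have hzero := (henergy N).unique
      ((hasDerivAt_const N _).congr_of_eventuallyEq (.of_forall fun t ↦ hconst t N))
    simpa using hzero
  intro N M
  have hqq : q N = q M := is_const_of_deriv_eq_zero (fun x ↦ (hq x).differentiableAt)
    (fun x ↦ (hq x).deriv.trans (hqp x)) N M
  exact ⟨hqq, by linarith [hqp N, hqp M]⟩
end

section
/- Let ξ ≥ 0 with ξ ≠ 2. Every trajectory (q,p) : ℝ → ℝ² of the planar system converges, as N → −∞ (the infinite future), to a zero of the vector field: there exists c with c = 0, or ξ > 2 and c ∈ {c₁, c₂}, such that (q(N), p(N)) → (cξ, cξ) as N → −∞. -/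
open Filter

/-- A quantitative form of Barbalat's lemma: if `g` converges at infinity and its second
derivative is bounded on `[0, ∞)`, then its derivative tends to zero. -/
theorem tendsto_deriv_zero_of_tendsto {g h k : ℝ → ℝ} {l K : ℝ}
    (hg : ∀ t, HasDerivAt g (h t) t) (hh : ∀ t, HasDerivAt h (k t) t)
    (hK : ∀ t, 0 ≤ t → |k t| ≤ K) (hl : Tendsto g atTop (nhds l)) :
    Tendsto h atTop (nhds 0) := by
  have hK0 : 0 ≤ K := (abs_nonneg _).trans (hK 0 le_rfl)
  rw [Metric.tendsto_atTop]
  intro ε hε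
  set δ : ℝ := ε / (2 * (K + 1)) with hδ
  have hδ0 : 0 < δ := by positivity
  have hKδ : K * δ < ε / 2 := by
    have : (K + 1) * δ = ε / 2 := by rw [hδ]; field_simp
    linarith
  obtain ⟨T, hT⟩ := Metric.tendsto_atTop.1 hl (δ * ε / 4) (by positivity)
  refine ⟨max T 0, fun t ht => ?_⟩
  have htT : T ≤ t := (le_max_left _ _).trans ht
  have ht0 : 0 ≤ t := (le_max_right _ _).trans ht
  obtain ⟨c, hc, hce⟩ := exists_hasDerivAt_eq_slope g h (show t < t + δ by linarith)
    (fun y _ => (hg y).continuousAt.continuousWithinAt) (fun y _ => hg y)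
  obtain ⟨d, hd, hde⟩ := exists_hasDerivAt_eq_slope h k hc.1
    (fun y _ => (hh y).continuousAt.continuousWithinAt) (fun y _ => hh y)
  have hct : 0 < c - t := sub_pos.2 hc.1
  rw [add_sub_cancel_left, eq_div_iff hδ0.ne'] at hce
  rw [eq_div_iff hct.ne'] at hde
  have h1 := abs_lt.1 (Real.dist_eq _ _ ▸ hT t htT)
  have h2 := abs_lt.1 (Real.dist_eq _ _ ▸ hT (t + δ) (by linarith))
  have hhc : |h c| < ε / 2 := by
    rw [abs_lt]
    constructor <;> nlinarith
  have hhd : |h c - h t| ≤ K * δ := by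
    rw [← hde, abs_mul, abs_of_pos hct]
    exact mul_le_mul (hK d (by linarith [hd.1])) (by linarith [hc.2]) hct.le hK0
  rw [Real.dist_eq, sub_zero, abs_lt]
  rw [abs_lt] at hhc
  rw [abs_le] at hhd
  constructor <;> linarith

/-- A bounded continuous curve along which a continuous function with finitely many zeros tends
to zero converges to one of these zeros. -/
theorem exists_tendsto_of_comp_tendsto_zero {f x : ℝ → ℝ} {R : ℝ} (hf : Continuous f)
    (hfin : {y | f y = 0}.Finite) (hx : Continuous x) (hR : ∀ t, 0 ≤ t → |x t| ≤ R)
    (hfx : Tendsto (fun t => f (x t)) atTop (nhds 0)) :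
    ∃ c, f c = 0 ∧ Tendsto x atTop (nhds c) := by
  have hR' : ∀ᶠ t in atTop, |x t| ≤ R := (eventually_ge_atTop 0).mono hR
  obtain ⟨c, hc⟩ : ∃ c, Tendsto x atTop (nhds c) := by
    refine tendsto_of_no_upcrossings dense_univ ?_
      ⟨R, hR'.mono fun t ht => (abs_le.1 ht).2⟩ ⟨-R, hR'.mono fun t ht => (abs_le.1 ht).1⟩
    rintro a - b - hab ⟨ha, hb⟩
    obtain ⟨m, hm, hfm⟩ := ((Set.Ioo_infinite hab).sdiff hfin).nonempty
    have hfm0 : 0 < |f m| := abs_pos.2 hfm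
    obtain ⟨T, hT⟩ := eventually_atTop.1 (Metric.tendsto_nhds.1 hfx _ hfm0)
    obtain ⟨s, hs, hsa⟩ := frequently_atTop.1 ha T
    obtain ⟨t, ht, htb⟩ := frequently_atTop.1 hb T
    obtain ⟨r, hr, hrm⟩ := intermediate_value_uIcc (a := s) (b := t) hx.continuousOn
      (Set.Icc_subset_uIcc ⟨hsa.le.trans hm.1.le, hm.2.le.trans htb.le⟩)
    have := hT r ((le_min hs ht).trans hr.1)
    rw [hrm, Real.dist_eq, sub_zero] at this
    exact lt_irrefl _ this
  exact ⟨c, tendsto_nhds_unique ((hf.tendsto c).comp hc) hfx, hc⟩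

/-- Solutions of the damped oscillator `x'' + 3 x' + 2 x (x ^ 2 - ξ x + 1) = 0` converge to an
equilibrium. -/
theorem dampedOscillator_tendsto {ξ : ℝ} {x v : ℝ → ℝ} (hx : ∀ t, HasDerivAt x (v t) t)
    (hv : ∀ t, HasDerivAt v (-3 * v t - 2 * (x t * (x t ^ 2 - ξ * x t + 1))) t) :
    ∃ c, c * (c ^ 2 - ξ * c + 1) = 0 ∧ Tendsto x atTop (nhds c) ∧ Tendsto v atTop (nhds 0) := by
  set E : ℝ → ℝ := fun t => v t ^ 2 / 2 + x t ^ 2 - 2 / 3 * ξ * x t ^ 3 + x t ^ 4 / 2 with hE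
  have hE' : ∀ t, HasDerivAt E (-3 * v t ^ 2) t := fun t => by
    refine ((((((hv t).pow 2).div_const 2).add ((hx t).pow 2)).sub
      (((hx t).pow 3).const_mul (2 / 3 * ξ))).add (((hx t).pow 4).div_const 2)).congr_deriv ?_
    push_cast
    ring
  have hlow : ∀ t, v t ^ 2 / 2 + x t ^ 2 ≤ E t + 16 / 81 * ξ ^ 4 := fun t => by
    simp only [hE]
    linarith [sq_nonneg (x t ^ 2 / 2 - 2 * ξ * x t / 3), sq_nonneg (x t ^ 2 / 2 - 4 / 9 * ξ ^ 2)]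
  have hanti : Antitone E := antitone_of_deriv_nonpos (fun t => (hE' t).differentiableAt)
    fun t => by rw [(hE' t).deriv]; linarith [sq_nonneg (v t)]
  have hElim : Tendsto E atTop (nhds (⨅ t, E t)) := by
    refine tendsto_atTop_ciInf hanti ⟨-(16 / 81 * ξ ^ 4), ?_⟩
    rintro _ ⟨t, rfl⟩
    linarith [hlow t, sq_nonneg (v t), sq_nonneg (x t)]
  obtain ⟨R, hRx, hRv⟩ : ∃ R, (∀ t, 0 ≤ t → |x t| ≤ R) ∧ ∀ t, 0 ≤ t → |v t| ≤ R := by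
    refine ⟨√(2 * (E 0 + 16 / 81 * ξ ^ 4)), fun t ht => ?_, fun t ht => ?_⟩ <;>
    · refine Real.abs_le_sqrt ?_
      linarith [hanti ht, hlow t, sq_nonneg (v t), sq_nonneg (x t)]
  have hbdd : ∀ F : ℝ × ℝ → ℝ, Continuous F → ∃ K, ∀ t, 0 ≤ t → |F (x t, v t)| ≤ K := by
    intro F hF
    obtain ⟨K, hK⟩ := ((isCompact_Icc (a := -R) (b := R)).prod
      (isCompact_Icc (a := -R) (b := R))).exists_bound_of_continuousOn hF.continuousOn
    exact ⟨K, fun t ht => hK _ ⟨abs_le.1 (hRx t ht), abs_le.1 (hRv t ht)⟩⟩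
  have hv0 : Tendsto v atTop (nhds 0) := by
    obtain ⟨K, hK⟩ := hbdd
      (fun y => -3 * (2 * y.2 * (-3 * y.2 - 2 * (y.1 * (y.1 ^ 2 - ξ * y.1 + 1))))) (by fun_prop)
    have h := tendsto_deriv_zero_of_tendsto hE'
      (fun t => by simpa using ((hv t).pow 2).const_mul (-3)) hK hElim
    have h2 : Tendsto (fun t => √(v t ^ 2)) atTop (nhds 0) := by
      have h3 := (h.const_mul (-1 / 3)).sqrt
      rw [mul_zero, Real.sqrt_zero] at h3
      exact h3.congr fun t => by ring_nf
    simp only [Real.sqrt_sq_eq_abs] at h2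
    exact (tendsto_zero_iff_abs_tendsto_zero v).2 h2
  have hfx : Tendsto (fun t => x t * (x t ^ 2 - ξ * x t + 1)) atTop (nhds 0) := by
    obtain ⟨K, hK⟩ := hbdd
      (fun y => -3 * (-3 * y.2 - 2 * (y.1 * (y.1 ^ 2 - ξ * y.1 + 1)))
        - 2 * (3 * y.1 ^ 2 - 2 * ξ * y.1 + 1) * y.2) (by fun_prop)
    have h := tendsto_deriv_zero_of_tendsto hv (fun t => ?_) hK hv0
    · have h3 := (h.add (hv0.const_mul 3)).const_mul (-1 / 2)
      simp only [mul_zero, add_zero] at h3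
      exact h3.congr fun t => by ring
    · refine (((hv t).const_mul (-3)).sub (((hx t).mul ((((hx t).pow 2).sub
        ((hx t).const_mul ξ)).add_const 1)).const_mul 2)).congr_deriv ?_
      simp only [Pi.sub_apply, Pi.pow_apply]
      push_cast
      ring
  have hfin : {y : ℝ | y * (y ^ 2 - ξ * y + 1) = 0}.Finite := by
    refine (Set.toFinite {0, (ξ - √(ξ ^ 2 - 4)) / 2, (ξ + √(ξ ^ 2 - 4)) / 2}).subset ?_
    intro y hy
    rcases mul_eq_zero.1 hy with h | h
    · exact Or.inl h
    · have hs := Real.sq_sqrt (show 0 ≤ ξ ^ 2 - 4 by linarith [sq_nonneg (2 * y - ξ)])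
      have : (y - (ξ - √(ξ ^ 2 - 4)) / 2) * (y - (ξ + √(ξ ^ 2 - 4)) / 2) = 0 := by
        linear_combination h - hs / 4
      rcases mul_eq_zero.1 this with h | h
      · exact Or.inr (Or.inl (sub_eq_zero.1 h))
      · exact Or.inr (Or.inr (sub_eq_zero.1 h))
  have hxc : Continuous x := continuous_iff_continuousAt.2 fun t => (hx t).continuousAt
  obtain ⟨c, hc, hlim⟩ := exists_tendsto_of_comp_tendsto_zero
    (f := fun y => y * (y ^ 2 - ξ * y + 1)) (by fun_prop) hfin hxc hRx hfx
  exact ⟨c, hc, hlim, hv0⟩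

/-- Let `ξ ≥ 0` with `ξ ≠ 2`. Every trajectory `(q,p) : ℝ → ℝ²` of the
planar system `dq/dN = q − p`, `dp/dN = 2(q³ − ξ q² + p)` converges, as `N → −∞`
(the infinite future), to a zero of the vector field: there exists `c` with `c = 0`,
or `ξ > 2` and `c ∈ {c₁, c₂}` (with `c₁ = (1 − √(1 − 4/ξ²))/2`,
`c₂ = (1 + √(1 − 4/ξ²))/2`), such that `(q(N), p(N)) → (cξ, cξ)` as `N → −∞`. -/
theorem trajectory_future_limit
    (ξ : ℝ) (hξ0 : 0 ≤ ξ) (hξ2 : ξ ≠ 2)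
    (q p : ℝ → ℝ)
    (hq : ∀ N : ℝ, HasDerivAt q (q N - p N) N)
    (hp : ∀ N : ℝ, HasDerivAt p (2 * (q N ^ 3 - ξ * q N ^ 2 + p N)) N) :
    ∃ c : ℝ,
      (c = 0 ∨ (2 < ξ ∧
        (c = (1 - Real.sqrt (1 - 4 / ξ ^ 2)) / 2 ∨
         c = (1 + Real.sqrt (1 - 4 / ξ ^ 2)) / 2))) ∧
      Tendsto (fun N => (q N, p N)) atBot (nhds (c * ξ, c * ξ)) := by
  obtain ⟨y, hy, hqlim, hvlim⟩ := dampedOscillator_tendsto (ξ := ξ) (x := fun t => q (-t))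
    (v := fun t => p (-t) - q (-t))
    (fun t => ((hq (-t)).scomp t (hasDerivAt_neg t)).congr_deriv (by simp))
    (fun t => by
      refine (((hp (-t)).scomp t (hasDerivAt_neg t)).sub
        ((hq (-t)).scomp t (hasDerivAt_neg t))).congr_deriv ?_
      simp only [smul_eq_mul]
      ring)
  have hlim : Tendsto (fun N => (q N, p N)) atBot (nhds (y, y)) := by
    have hplim := hvlim.add hqlim
    simp only [sub_add_cancel, zero_add] at hplim
    simpa [Function.comp_def] using (hqlim.prodMk_nhds hplim).comp tendsto_neg_atBot_atTop
  rcases mul_eq_zero.1 hy with rfl | hy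
  · exact ⟨0, Or.inl rfl, by simpa using hlim⟩
  have hξ : 2 < ξ := by
    refine lt_of_le_of_ne ?_ hξ2.symm
    nlinarith [sq_nonneg (2 * y - ξ)]
  have hξpos : 0 < ξ := by linarith
  have hs := Real.sq_sqrt (show 0 ≤ 1 - 4 / ξ ^ 2 by
    rw [sub_nonneg, div_le_one (by positivity)]
    nlinarith)
  refine ⟨y / ξ, Or.inr ⟨hξ, ?_⟩, by rwa [div_mul_cancel₀ _ hξpos.ne']⟩
  have : (y / ξ - (1 - √(1 - 4 / ξ ^ 2)) / 2) * (y / ξ - (1 + √(1 - 4 / ξ ^ 2)) / 2) = 0 := by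
    have h : (y / ξ) ^ 2 - y / ξ + 1 / ξ ^ 2 = 0 := by
      field_simp
      linear_combination hy
    linear_combination h - hs / 4
  exact (mul_eq_zero.1 this).imp sub_eq_zero.1 sub_eq_zero.1
end

section
/- Let ξ ≥ 0 with ξ ≠ 2. Every trajectory (q,p) : ℝ → ℝ² of the planar system satisfies exactly one of the following two conditions: (a) D(q(N), p(N)) ≤ 0 for all N ∈ ℝ, and (q(N), p(N)) converges as N → +∞ (the infinite past) to a zero of the vector field; or (b) p(N)² + q(N)⁴ → +∞ as N → +∞. -/
open Filter

open MeasureTheory Set Topology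

/-- A bounded continuous function converges at infinity if a function with finite level sets
converges along it. -/
lemma exists_tendsto_of_tendsto_comp_of_finite_level {f g : ℝ → ℝ} {L B : ℝ} (hf : Continuous f)
    (hB : ∀ x, |f x| ≤ B) (hL : {y | g y = L}.Finite)
    (h : Tendsto (fun x => g (f x)) atTop (𝓝 L)) : ∃ c, Tendsto f atTop (𝓝 c) := by
  refine tendsto_of_no_upcrossings dense_univ ?_
    (isBoundedUnder_of ⟨B, fun x => (abs_le.1 (hB x)).2⟩)
    (isBoundedUnder_of ⟨-B, fun x => (abs_le.1 (hB x)).1⟩)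
  rintro a - b - hab ⟨ha, hb⟩
  refine Ioo_infinite hab (hL.subset fun y hy => ?_)
  by_contra hne
  obtain ⟨M, hM⟩ := eventually_atTop.1 (h.eventually_ne (Ne.symm hne))
  obtain ⟨m, hm, hma⟩ := frequently_atTop.1 ha M
  obtain ⟨n, hn, hnb⟩ := frequently_atTop.1 hb M
  obtain ⟨x, hx, hxy⟩ := intermediate_value_uIcc (a := m) (b := n) hf.continuousOn
    (Icc_subset_uIcc ⟨(hma.trans hy.1).le, (hy.2.trans hnb).le⟩)
  exact hM x ((le_inf hm hn).trans hx.1) (by rw [hxy])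

/-- If a function and its derivative both converge at infinity, the derivative tends to `0`. -/
lemma eq_zero_of_tendsto_of_tendsto_deriv {f f' : ℝ → ℝ} {c l : ℝ}
    (hf : ∀ x, HasDerivAt f (f' x) x) (hc : Tendsto f atTop (𝓝 c))
    (hl : Tendsto f' atTop (𝓝 l)) : l = 0 := by
  have hmv : ∀ x : ℝ, ∃ y ∈ Ioo x (x + 1), f' y = (f (x + 1) - f x) / (x + 1 - x) := fun x =>
    exists_hasDerivAt_eq_slope f f' (by linarith) (fun y _ => (hf y).continuousAt.continuousWithinAt)
      fun y _ => hf y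
  choose y hy hy' using hmv
  have hyt : Tendsto y atTop atTop := tendsto_atTop_mono (fun x => (hy x).1.le) tendsto_id
  have hdiff : Tendsto (fun x => f (x + 1) - f x) atTop (𝓝 (c - c)) :=
    (hc.comp (tendsto_atTop_add_const_right _ 1 tendsto_id)).sub hc
  rw [sub_self] at hdiff
  refine tendsto_nhds_unique (hl.comp hyt) (hdiff.congr fun x => ?_)
  simp [hy']

/-- A form of Barbalat's lemma: a function with bounded derivative whose square has a convergent
primitive tends to `0`. -/
lemma tendsto_zero_of_tendsto_primitive_sq {F u u' : ℝ → ℝ} {l C : ℝ}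
    (hF : ∀ x, HasDerivAt F (u x ^ 2) x) (hu : ∀ x, HasDerivAt u (u' x) x)
    (hu' : Continuous u') (hCu : ∀ x, |u x| ≤ C) (hCu' : ∀ x, |u' x| ≤ C)
    (hl : Tendsto F atTop (𝓝 l)) : Tendsto u atTop (𝓝 0) := by
  have hcu : Continuous u := continuous_iff_continuousAt.2 fun x => (hu x).continuousAt
  have hint : IntegrableOn (fun x => u x ^ 2) (Ioi 0) :=
    integrableOn_Ioi_deriv_of_nonneg' (fun x _ => hF x) (fun x _ => sq_nonneg _) hl
  have hint₁ : IntegrableOn (fun x => u x * u x ^ 2) (Ioi 0) :=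
    hint.bdd_mul hcu.aestronglyMeasurable (ae_of_all _ hCu)
  have hint₂ : IntegrableOn (fun x => u' x * u x ^ 2) (Ioi 0) :=
    hint.bdd_mul hu'.aestronglyMeasurable (ae_of_all _ hCu')
  have hcube : Tendsto (fun x => u x * u x ^ 2) atTop (𝓝 0) := by
    refine tendsto_zero_of_hasDerivAt_of_integrableOn_Ioi (a := 0)
      (f' := fun x => 3 * (u' x * u x ^ 2)) (fun x _ => ?_) (hint₂.const_mul 3) hint₁
    refine ((hu x).mul ((hu x).pow 2)).congr_deriv ?_
    simp
    ring
  rw [tendsto_zero_iff_abs_tendsto_zero] at hcube ⊢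
  have := hcube.rpow_const (p := (1 / 3 : ℝ)) (Or.inr (by norm_num))
  rw [Real.zero_rpow (by norm_num)] at this
  refine this.congr fun x => ?_
  have h3 : |u x * u x ^ 2| = |u x| ^ (3 : ℝ) := by
    rw [abs_mul, abs_pow]
    norm_cast
    ring
  simp only [Function.comp_apply]
  rw [h3, ← Real.rpow_mul (abs_nonneg _)]
  norm_num

lemma finite_quartic_level (ξ L : ℝ) :
    {x : ℝ | x ^ 4 / 2 - 2 / 3 * ξ * x ^ 3 + x ^ 2 = L}.Finite := by
  let P : Polynomial ℝ := .X ^ 4 - .C (4 / 3 * ξ) * .X ^ 3 + .C 2 * .X ^ 2 - .C (2 * L)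
  have hP : P.Monic := by
    unfold P
    monicity!
  refine (Polynomial.finite_setOfPred_isRoot hP.ne_zero).subset fun x hx => ?_
  simp only [mem_ofPred_eq] at hx
  simp [P]
  linarith

/-- If `D' ≥ 3 D` and `D` is positive somewhere, then `D` blows up at infinity. -/
lemma tendsto_atTop_of_three_mul_le_deriv {D D' : ℝ → ℝ} (hD : ∀ x, HasDerivAt D (D' x) x)
    (hle : ∀ x, 3 * D x ≤ D' x) {a : ℝ} (ha : 0 < D a) : Tendsto D atTop atTop := by
  have hderiv : ∀ x, HasDerivAt (fun t => D t * Real.exp (-3 * t))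
      ((D' x - 3 * D x) * Real.exp (-3 * x)) x := fun x => by
    refine ((hD x).mul (((hasDerivAt_id x).const_mul (-3)).exp)).congr_deriv ?_
    simp
    ring
  have hmono : Monotone fun t => D t * Real.exp (-3 * t) :=
    monotone_of_deriv_nonneg (fun x => (hderiv x).differentiableAt) fun x => by
      rw [(hderiv x).deriv]
      exact mul_nonneg (sub_nonneg.2 (hle x)) (Real.exp_pos _).le
  have hexp : Tendsto (fun x => D a * Real.exp (-3 * a) * Real.exp (3 * x)) atTop atTop :=
    (Real.tendsto_exp_atTop.comp (tendsto_id.const_mul_atTop (by norm_num))).const_mul_atTop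
      (mul_pos ha (Real.exp_pos _))
  refine tendsto_atTop_mono' _ ?_ hexp
  filter_upwards [eventually_ge_atTop a] with x hx
  calc D a * Real.exp (-3 * a) * Real.exp (3 * x)
      ≤ D x * Real.exp (-3 * x) * Real.exp (3 * x) := mul_le_mul_of_nonneg_right (hmono hx) (Real.exp_pos _).le
    _ = D x := by rw [mul_assoc, ← Real.exp_add]; simp

lemma bounds_of_sq_add_pow_four_le {B q p : ℝ} (hB : 0 ≤ B) (h : p ^ 2 + q ^ 4 - B * q ^ 3 ≤ 0) :
    |q| ≤ B ∧ |p| ≤ B ^ 2 := by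
  have hq0 : 0 ≤ q := by
    by_contra! hq
    have h3 : 0 < -q ^ 3 := by have := pow_pos (neg_pos.2 hq) 3; nlinarith
    have h4 : 0 < q ^ 4 := by have := hq.ne; positivity
    nlinarith [sq_nonneg p, mul_nonneg hB h3.le]
  have hqB : q ≤ B := by
    by_contra! hq
    have hpos : 0 < q := hB.trans_lt hq
    have : 0 < q ^ 3 * (q - B) := mul_pos (by positivity) (sub_pos.2 hq)
    nlinarith [sq_nonneg p]
  refine ⟨by rwa [abs_of_nonneg hq0], abs_le_of_sq_le_sq (b := B ^ 2) ?_ (by positivity)⟩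
  have h3 : q ^ 3 ≤ B ^ 3 := by gcongr
  have h4 : 0 ≤ q ^ 4 := by positivity
  nlinarith [mul_le_mul_of_nonneg_left h3 hB]

lemma zero_of_vector_field {ξ x : ℝ} (hξ0 : 0 ≤ ξ) (hξ2 : ξ ≠ 2)
    (h : 2 * (x ^ 3 - ξ * x ^ 2 + x) = 0) :
    ∃ c : ℝ, (c = 0 ∨ (2 < ξ ∧ (c = (1 - Real.sqrt (1 - 4 / ξ ^ 2)) / 2 ∨
      c = (1 + Real.sqrt (1 - 4 / ξ ^ 2)) / 2))) ∧ c * ξ = x := by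
  by_cases hx : x = 0
  · exact ⟨0, Or.inl rfl, by simp [hx]⟩
  have hquad : x ^ 2 - ξ * x + 1 = 0 := by
    refine (mul_eq_zero.1 (?_ : x * (x ^ 2 - ξ * x + 1) = 0)).resolve_left hx
    linarith
  have hlt : 2 < ξ := by
    refine lt_of_le_of_ne ?_ hξ2.symm
    nlinarith [sq_nonneg (2 * x - ξ)]
  have hξ : ξ ≠ 0 := by positivity
  refine ⟨x / ξ, Or.inr ⟨hlt, ?_⟩, by field_simp⟩
  have hsq : Real.sqrt (1 - 4 / ξ ^ 2) = |2 * (x / ξ) - 1| := by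
    rw [← Real.sqrt_sq_eq_abs]
    congr 1
    field_simp
    linarith
  rcases abs_choice (2 * (x / ξ) - 1) with h' | h' <;> rw [hsq, h']
  · right; ring
  · left; ring

lemma trajectory_tendsto_of_bounded {ξ B : ℝ} {q p : ℝ → ℝ}
    (hq : ∀ N : ℝ, HasDerivAt q (q N - p N) N)
    (hp : ∀ N : ℝ, HasDerivAt p (2 * (q N ^ 3 - ξ * q N ^ 2 + p N)) N)
    (hqB : ∀ N, |q N| ≤ B) (hpB : ∀ N, |p N| ≤ B) :
    ∃ x : ℝ, 2 * (x ^ 3 - ξ * x ^ 2 + x) = 0 ∧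
      Tendsto (fun N => (q N, p N)) atTop (𝓝 (x, x)) := by
  have hqc : Continuous q := continuous_iff_continuousAt.2 fun x => (hq x).continuousAt
  have hpc : Continuous p := continuous_iff_continuousAt.2 fun x => (hp x).continuousAt
  have hbdd : ∀ g : ℝ × ℝ → ℝ, Continuous g → ∃ C, ∀ N, |g (q N, p N)| ≤ C := fun g hg => by
    obtain ⟨C, hC⟩ := ((isCompact_Icc (a := -B) (b := B)).prod
      (isCompact_Icc (a := -B) (b := B))).exists_bound_of_continuousOn hg.continuousOn
    exact ⟨C, fun N => hC _ ⟨abs_le.1 (hqB N), abs_le.1 (hpB N)⟩⟩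
  set V : ℝ → ℝ := fun x => x ^ 4 / 2 - 2 / 3 * ξ * x ^ 3 + x ^ 2
  set F : ℝ → ℝ := fun N => ((q N - p N) ^ 2 / 2 + V (q N)) / 3 with hF
  have hFd : ∀ N, HasDerivAt F ((q N - p N) ^ 2) N := fun N => by
    have hVq : HasDerivAt (fun t => V (q t)) _ N :=
      ((((hq N).pow 4).div_const 2).sub (((hq N).pow 3).const_mul (2 / 3 * ξ))).add ((hq N).pow 2)
    refine ((((((hq N).sub (hp N)).pow 2).div_const 2).add hVq).div_const 3).congr_deriv ?_
    simp
    ring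
  obtain ⟨CF, hCF⟩ := hbdd (fun z => ((z.1 - z.2) ^ 2 / 2 + V z.1) / 3) (by fun_prop)
  have hFmono : Monotone F := monotone_of_deriv_nonneg (fun x => (hFd x).differentiableAt)
    fun x => by rw [(hFd x).deriv]; positivity
  have hFlim := tendsto_atTop_ciSup hFmono
    ⟨CF, by rintro _ ⟨N, rfl⟩; exact (abs_le.1 (hCF N)).2⟩
  set L := ⨆ N, F N
  obtain ⟨C₁, hC₁⟩ := hbdd (fun z => z.1 - z.2) (by fun_prop)
  obtain ⟨C₂, hC₂⟩ := hbdd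
    (fun z => (z.1 - z.2) - 2 * (z.1 ^ 3 - ξ * z.1 ^ 2 + z.2)) (by fun_prop)
  have hu : Tendsto (fun N => q N - p N) atTop (𝓝 0) :=
    tendsto_zero_of_tendsto_primitive_sq (C := max C₁ C₂) hFd (fun N => (hq N).sub (hp N))
      (by fun_prop) (fun N => (hC₁ N).trans (le_max_left _ _))
      (fun N => (hC₂ N).trans (le_max_right _ _)) hFlim
  have hVlim : Tendsto (fun N => V (q N)) atTop (𝓝 (3 * L)) := by
    have := (hFlim.const_mul 3).sub ((hu.pow 2).div_const 2)
    norm_num at this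
    refine this.congr fun N => ?_
    simp only [hF]
    ring
  obtain ⟨x, hx⟩ := exists_tendsto_of_tendsto_comp_of_finite_level hqc hqB
    (finite_quartic_level ξ _) hVlim
  have hpx : Tendsto p atTop (𝓝 x) := by
    have := hx.sub hu
    simpa using this
  exact ⟨x, eq_zero_of_tendsto_of_tendsto_deriv hp hpx
    ((((hx.pow 3).sub ((hx.pow 2).const_mul ξ)).add hpx).const_mul 2), hx.prodMk_nhds hpx⟩

lemma tendsto_of_tendsto_sub_cube {α : Type*} {l : Filter α} {ξ : ℝ} (hξ : 0 ≤ ξ) {q p : α → ℝ}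
    (h : Tendsto (fun N => p N ^ 2 + q N ^ 4 - (4 / 3) * ξ * q N ^ 3) l atTop) :
    Tendsto (fun N => p N ^ 2 + q N ^ 4) l atTop := by
  have hbound : ∀ N, (p N ^ 2 + q N ^ 4 - (4 / 3) * ξ * q N ^ 3) - (4 / 3) * ξ ≤
      (1 + (4 / 3) * ξ) * (p N ^ 2 + q N ^ 4) := fun N => by
    have hcube : 0 ≤ q N ^ 4 + q N ^ 3 + 1 := by
      nlinarith [sq_nonneg (q N ^ 2 + q N / 2 - 1 / 2), sq_nonneg (q N + 1), sq_nonneg (q N)]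
    nlinarith [mul_nonneg hξ hcube, mul_nonneg hξ (sq_nonneg (p N))]
  exact (tendsto_const_mul_atTop_of_pos (by positivity)).1
    (tendsto_atTop_mono hbound (tendsto_atTop_add_const_right _ _ h))

/-- **dichotomy.** Let `ξ ≥ 0` with `ξ ≠ 2`. Every trajectory
`(q,p) : ℝ → ℝ²` of the planar system `dq/dN = q − p`, `dp/dN = 2(q³ − ξ q² + p)`
satisfies exactly one of:
(a) `D(q(N), p(N)) ≤ 0` for all `N ∈ ℝ` (with `D(q,p) = p² + q⁴ − (4/3)ξ q³`), and
`(q(N), p(N))` converges as `N → +∞` (the infinite past) to a zero of the vector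
field; or (b) `p(N)² + q(N)⁴ → +∞` as `N → +∞`. -/
theorem trajectory_dichotomy
    (ξ : ℝ) (hξ0 : 0 ≤ ξ) (hξ2 : ξ ≠ 2)
    (q p : ℝ → ℝ)
    (hq : ∀ N : ℝ, HasDerivAt q (q N - p N) N)
    (hp : ∀ N : ℝ, HasDerivAt p (2 * (q N ^ 3 - ξ * q N ^ 2 + p N)) N) :
    Xor'
      ((∀ N : ℝ, p N ^ 2 + q N ^ 4 - (4/3) * ξ * q N ^ 3 ≤ 0) ∧
        ∃ c : ℝ,
          (c = 0 ∨ (2 < ξ ∧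
            (c = (1 - Real.sqrt (1 - 4 / ξ ^ 2)) / 2 ∨
             c = (1 + Real.sqrt (1 - 4 / ξ ^ 2)) / 2))) ∧
          Tendsto (fun N => (q N, p N)) atTop (nhds (c * ξ, c * ξ)))
      (Tendsto (fun N => p N ^ 2 + q N ^ 4) atTop atTop) := by
  have hDd : ∀ N, HasDerivAt (fun N => p N ^ 2 + q N ^ 4 - (4/3) * ξ * q N ^ 3)
      (4 * p N ^ 2 + 4 * q N ^ 4 - 4 * ξ * q N ^ 3) N := fun N => by
    refine ((((hp N).pow 2).add ((hq N).pow 4)).sub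
      (((hq N).pow 3).const_mul ((4/3) * ξ))).congr_deriv ?_
    simp
    ring
  by_cases hD : ∀ N : ℝ, p N ^ 2 + q N ^ 4 - (4/3) * ξ * q N ^ 3 ≤ 0
  · have hbd := fun N => bounds_of_sq_add_pow_four_le (by positivity) (hD N)
    obtain ⟨x, hx, hlim⟩ := trajectory_tendsto_of_bounded hq hp
      (fun N => (hbd N).1.trans (le_max_left _ _)) (fun N => (hbd N).2.trans (le_max_right _ _))
    obtain ⟨c, hc, rfl⟩ := zero_of_vector_field hξ0 hξ2 hx
    refine Or.inl ⟨⟨hD, c, hc, hlim⟩, ?_⟩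
    have hcont : Continuous fun z : ℝ × ℝ => z.2 ^ 2 + z.1 ^ 4 := by fun_prop
    exact not_tendsto_atTop_of_tendsto_nhds ((hcont.tendsto _).comp hlim)
  · refine Or.inr ⟨?_, fun h => hD h.1⟩
    push Not at hD
    obtain ⟨a, ha⟩ := hD
    refine tendsto_of_tendsto_sub_cube hξ0
      (tendsto_atTop_of_three_mul_le_deriv hDd (fun N => ?_) ha)
    have : 0 ≤ p N ^ 2 + q N ^ 4 := by positivity
    linarith
end

section
/- Let ξ ≥ 0 and let f : (−∞,0) → ℝ be a background solution. If (−τ)·ω_s(τ) → +∞ as τ → −∞, then the limit lim_{τ→−∞} ω_s(τ) exists (as a real number). -/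
open Filter

/-- A nonnegative function whose derivative is at least `-C / x²` near `-∞` converges at `-∞`. -/
theorem exists_tendsto_atBot_of_neg_div_sq_le_deriv
    {w w' : ℝ → ℝ} {C T : ℝ} (hC : 0 ≤ C) (hT : T < 0)
    (hw : ∀ x ≤ T, HasDerivAt w (w' x) x)
    (hw_nonneg : ∀ x ≤ T, 0 ≤ w x)
    (hw' : ∀ x ≤ T, -(C / x ^ 2) ≤ w' x) :
    ∃ l : ℝ, Tendsto w atBot (nhds l) := by
  have hderiv : ∀ x ≤ T, HasDerivAt (fun y => w y - C * y⁻¹) (w' x - C * (-(x ^ 2)⁻¹)) x :=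
    fun x hx => (hw x hx).sub ((hasDerivAt_inv (by linarith)).const_mul C)
  have hmono : MonotoneOn (fun y => w y - C * y⁻¹) (Set.Iic T) := by
    refine monotoneOn_of_hasDerivWithinAt_nonneg (convex_Iic T)
      (fun x hx => (hderiv x hx).continuousAt.continuousWithinAt)
      (fun x hx => (hderiv x (interior_subset (s := Set.Iic T) hx)).hasDerivWithinAt) fun x hx => ?_
    have := hw' x (interior_subset (s := Set.Iic T) hx)
    rw [div_eq_mul_inv] at this
    linarith
  have hmin : Monotone (fun y => w (min y T) - C * (min y T)⁻¹) := fun x y hxy =>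
    hmono (min_le_right x T) (min_le_right y T) (min_le_min_right T hxy)
  have hbdd : BddBelow (Set.range fun y => w (min y T) - C * (min y T)⁻¹) := by
    refine ⟨0, ?_⟩
    rintro _ ⟨y, rfl⟩
    have h1 := hw_nonneg _ (min_le_right y T)
    have h2 : (min y T)⁻¹ ≤ 0 := inv_nonpos.2 ((min_le_right y T).trans hT.le)
    have h3 := mul_nonpos_of_nonneg_of_nonpos hC h2
    simp only
    linarith
  have hlim := (tendsto_atBot_ciInf hmin hbdd).add
    ((tendsto_inv_atBot_zero (𝕜 := ℝ)).const_mul C)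
  refine ⟨_, hlim.congr' ?_⟩
  filter_upwards [eventually_le_atBot T] with x hx
  rw [min_eq_left hx]
  ring

/-- If `E = p² + q⁴`, the rate of change `2 p k` of `E` with forcing
`k = 6 a² q u² + c u³` is controlled by `E^(3/4) u²` as soon as `u ≤ E^(1/4)`. -/
theorem neg_le_two_mul_forcing {p q u v a c : ℝ} (hu : 0 ≤ u) (huv : u ≤ v)
    (hE : p ^ 2 + q ^ 4 = v ^ 4) :
    -((12 * a ^ 2 + 2 * |c|) * u ^ 2 * v ^ 3) ≤ 2 * p * (6 * a ^ 2 * q * u ^ 2 + c * u ^ 3) := by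
  have hv : 0 ≤ v := hu.trans huv
  have hp : |p| ≤ v ^ 2 :=
    abs_le_of_sq_le_sq (by nlinarith [pow_nonneg (sq_nonneg q) 2]) (by positivity)
  have hq : |q| ≤ v := by
    have h : |q| ^ 4 ≤ v ^ 4 := by
      rw [Even.pow_abs (by decide)]
      nlinarith [sq_nonneg p]
    exact le_of_pow_le_pow_left₀ (by norm_num) hv h
  have hk : |6 * a ^ 2 * q * u ^ 2 + c * u ^ 3| ≤ (6 * a ^ 2 + |c|) * u ^ 2 * v := by
    calc |6 * a ^ 2 * q * u ^ 2 + c * u ^ 3|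
        ≤ |6 * a ^ 2 * q * u ^ 2| + |c * u ^ 3| := abs_add_le _ _
      _ = 6 * a ^ 2 * |q| * u ^ 2 + |c| * (u ^ 2 * u) := by
          simp only [abs_mul, abs_pow, sq_abs, abs_of_nonneg hu]
          rw [abs_of_pos (by norm_num : (0:ℝ) < 6)]
          ring
      _ ≤ 6 * a ^ 2 * v * u ^ 2 + |c| * (u ^ 2 * v) := by gcongr
      _ = (6 * a ^ 2 + |c|) * u ^ 2 * v := by ring
  have h := mul_le_mul hp hk (abs_nonneg _) (by positivity)
  rw [← abs_mul] at h
  have := neg_abs_le (p * (6 * a ^ 2 * q * u ^ 2 + c * u ^ 3))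
  linarith

/-- Let `ξ ≥ 0` and let `f` be a background solution of
`f'' + 2 f³ − (2ξ/(−τ)) f² = 0` on `(−∞,0)`. With `s(τ) = f(τ) − ξ/(−3τ)`
(so that `s'(τ) = f'(τ) − ξ/(3τ²)`) and `ω_s(τ) = (s'(τ)² + s(τ)⁴)^{1/4}`:
if `(−τ)·ω_s(τ) → +∞` as `τ → −∞`, then the limit `lim_{τ→−∞} ω_s(τ)` exists
(as a real number). -/
theorem omega_s_limit_exists
    (ξ : ℝ) (hξ0 : 0 ≤ ξ)
    (f f' f'' : ℝ → ℝ)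
    (hf : ∀ τ < (0:ℝ), HasDerivAt f (f' τ) τ)
    (hf' : ∀ τ < (0:ℝ), HasDerivAt f' (f'' τ) τ)
    (hf''cont : ContinuousOn f'' (Set.Iio 0))
    (hode : ∀ τ < (0:ℝ), f'' τ + 2 * f τ ^ 3 - (2 * ξ / (-τ)) * f τ ^ 2 = 0)
    (hgrow : Tendsto
      (fun τ => (-τ) *
        (((f' τ - ξ / (3 * τ ^ 2)) ^ 2 + (f τ - ξ / (-3 * τ)) ^ 4) ^ ((1:ℝ)/4)))
      atBot atTop) :
    ∃ ω : ℝ, Tendsto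
      (fun τ => ((f' τ - ξ / (3 * τ ^ 2)) ^ 2 + (f τ - ξ / (-3 * τ)) ^ 4) ^ ((1:ℝ)/4))
      atBot (nhds ω) := by
  have hlt : ∀ᶠ τ : ℝ in atBot, τ < 0 := eventually_lt_atBot 0
  obtain ⟨T₀, hT₀⟩ := eventually_atBot.1 (hlt.and (hgrow.eventually_ge_atTop 1))
  set E : ℝ → ℝ := fun τ => (f' τ - ξ / (3 * τ ^ 2)) ^ 2 + (f τ - ξ / (-3 * τ)) ^ 4 with hE
  set a : ℝ := ξ / 3 with ha
  set c : ℝ := 4 * a ^ 3 - 2 * a with hc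
  have hT₀neg := (hT₀ T₀ le_rfl).1
  have hEnonneg : ∀ τ, 0 ≤ E τ := fun τ => by
    simp only [hE]
    positivity
  have hpow : ∀ τ, E τ = (E τ ^ ((1:ℝ)/4)) ^ 4 := fun τ => by
    rw [← Real.rpow_natCast, ← Real.rpow_mul (hEnonneg τ)]
    norm_num
  have hEderiv : ∀ τ < 0, HasDerivAt E (2 * (f' τ - ξ / (3 * τ ^ 2)) *
      (6 * a ^ 2 * (f τ - ξ / (-3 * τ)) * (-τ)⁻¹ ^ 2 + c * (-τ)⁻¹ ^ 3)) τ := by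
    intro τ hτ
    have hne : τ ≠ 0 := hτ.ne
    have hs : HasDerivAt (fun y => f y - ξ / (-3 * y)) (f' τ - ξ / (3 * τ ^ 2)) τ := by
      have h := (hf τ hτ).sub ((hasDerivAt_const τ ξ).div
        ((hasDerivAt_id τ).const_mul (-3)) (by simpa using hne))
      refine h.congr_deriv ?_
      simp only [id]
      field_simp
      ring
    have hs' : HasDerivAt (fun y => f' y - ξ / (3 * y ^ 2)) (f'' τ + 2 * ξ / (3 * τ ^ 3)) τ := by
      have h := (hf' τ hτ).sub ((hasDerivAt_const τ ξ).div
        ((hasDerivAt_pow 2 τ).const_mul 3) (by positivity))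
      refine h.congr_deriv ?_
      field_simp
      norm_num
      ring
    refine ((hs'.pow 2).add (hs.pow 4)).congr_deriv ?_
    have hf''eq : f'' τ = 2 * ξ / (-τ) * f τ ^ 2 - 2 * f τ ^ 3 := by linarith [hode τ hτ]
    rw [hf''eq, hc, ha, inv_neg]
    norm_num
    field_simp
    ring
  refine exists_tendsto_atBot_of_neg_div_sq_le_deriv (C := (12 * a ^ 2 + 2 * |c|) / 4)
    (by positivity) hT₀neg (fun τ hτ => ((hEderiv τ (hT₀ τ hτ).1).rpow_const (Or.inl ?_)))
    (fun τ _ => Real.rpow_nonneg (hEnonneg τ) _) fun τ hτ => ?_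
  · intro h0
    have h1 := (hT₀ τ hτ).2
    change 1 ≤ -τ * E τ ^ ((1:ℝ)/4) at h1
    rw [h0, Real.zero_rpow (by norm_num)] at h1
    linarith
  · obtain ⟨hτ0, h1⟩ := hT₀ τ hτ
    change 1 ≤ -τ * E τ ^ ((1:ℝ)/4) at h1
    have hτpos : 0 < -τ := neg_pos.2 hτ0
    have huv : (-τ)⁻¹ ≤ E τ ^ ((1:ℝ)/4) := (inv_le_iff_one_le_mul₀' hτpos).2 h1
    have hupos : 0 < (-τ)⁻¹ := inv_pos.2 hτpos
    have hvpos := hupos.trans_le huv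
    have hexp : E τ ^ ((1:ℝ)/4 - 1) = ((E τ ^ ((1:ℝ)/4)) ^ 3)⁻¹ := by
      rw [← Real.rpow_natCast, ← Real.rpow_mul (hEnonneg τ), ← Real.rpow_neg (hEnonneg τ)]
      norm_num
    have hbound := neg_le_two_mul_forcing (a := a) (c := c) hupos.le huv (hpow τ)
    rw [hexp, ← div_eq_mul_inv, le_div_iff₀ (pow_pos hvpos 3)]
    have hsq : (τ ^ 2)⁻¹ = (-τ)⁻¹ ^ 2 := by rw [inv_pow, neg_sq]
    rw [div_eq_mul_inv _ (τ ^ 2), hsq]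
    linarith
end

section
/- Let ξ ≥ 0 and let f : (−∞,0) → ℝ be a background solution such that (−τ)·ω_s(τ) → +∞ as τ → −∞. Then the limit ω := lim_{τ→−∞} ω_s(τ) is strictly positive, and s is bounded near −∞: there exists τ* < 0 such that |s(τ)| ≤ 2ω for all τ ≤ τ*. -/
open Filter

/-- A nonnegative function whose derivative is `O(τ⁻²)` at `−∞` and which decays more slowly
than `1 / (−τ)` has a strictly positive limit at `−∞`. -/
theorem exists_pos_tendsto_atBot_of_abs_deriv_le {W W' : ℝ → ℝ} {K T : ℝ} (hT : T < 0)
    (hW : ∀ τ ≤ T, HasDerivAt W (W' τ) τ) (hbound : ∀ τ ≤ T, |W' τ| ≤ K / τ ^ 2)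
    (hnonneg : ∀ τ, 0 ≤ W τ) (hgrow : Tendsto (fun τ => (-τ) * W τ) atBot atTop) :
    ∃ ω : ℝ, Tendsto W atBot (nhds ω) ∧ 0 < ω := by
  have hK : 0 ≤ K := by
    have h := (abs_nonneg _).trans (hbound T le_rfl)
    have hT2 : 0 < T ^ 2 := by nlinarith
    by_contra hneg
    exact absurd h (not_le.mpr (div_neg_of_neg_of_pos (not_le.mp hneg) hT2))
  have hderiv : ∀ c : ℝ, ∀ τ ≤ T,
      HasDerivAt (fun τ => W τ + c * (-τ⁻¹)) (W' τ + c / τ ^ 2) τ := by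
    intro c τ hτ
    have h0 : τ ≠ 0 := by linarith
    refine ((hW τ hτ).add (((hasDerivAt_inv h0).neg).const_mul c)).congr_deriv ?_
    field_simp
  have hint : ∀ {τ : ℝ}, τ ∈ interior (Set.Iic T) → τ ≤ T := fun hτ =>
    Set.mem_Iic.mp (interior_subset hτ)
  have hmono : MonotoneOn (fun τ => W τ + K * (-τ⁻¹)) (Set.Iic T) := by
    refine monotoneOn_of_hasDerivWithinAt_nonneg (f' := fun τ => W' τ + K / τ ^ 2)
      (convex_Iic T) (fun τ hτ => (hderiv K τ hτ).continuousAt.continuousWithinAt)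
      (fun τ hτ => (hderiv K τ (hint hτ)).hasDerivWithinAt) (fun τ hτ => ?_)
    linarith [(abs_le.mp (hbound τ (hint hτ))).1]
  have hanti : AntitoneOn (fun τ => W τ + (-K) * (-τ⁻¹)) (Set.Iic T) := by
    refine antitoneOn_of_hasDerivWithinAt_nonpos (f' := fun τ => W' τ + (-K) / τ ^ 2)
      (convex_Iic T) (fun τ hτ => (hderiv (-K) τ hτ).continuousAt.continuousWithinAt)
      (fun τ hτ => (hderiv (-K) τ (hint hτ)).hasDerivWithinAt) (fun τ hτ => ?_)
    rw [neg_div]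
    linarith [(abs_le.mp (hbound τ (hint hτ))).2]
  have hinv : ∀ c : ℝ, Tendsto (fun τ : ℝ => c * (-τ⁻¹)) atBot (nhds 0) := by
    intro c
    simpa using ((tendsto_inv_atBot_zero (𝕜 := ℝ)).neg).const_mul c
  have hmono' : Monotone (fun τ => W (min τ T) + K * (-(min τ T)⁻¹)) := fun a b hab =>
    hmono (min_le_right a T) (min_le_right b T) (min_le_min_right T hab)
  have hbdd : BddBelow (Set.range (fun τ => W (min τ T) + K * (-(min τ T)⁻¹))) := by
    refine ⟨0, ?_⟩
    rintro _ ⟨τ, rfl⟩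
    have h1 : (min τ T)⁻¹ ≤ 0 := inv_nonpos.mpr ((min_le_right τ T).trans hT.le)
    have h2 := mul_nonneg hK (neg_nonneg.mpr h1)
    have h3 := hnonneg (min τ T)
    dsimp only
    linarith
  obtain ⟨ω, hω⟩ : ∃ ω, Tendsto W atBot (nhds ω) := by
    have h := (tendsto_atBot_ciInf hmono' hbdd).sub (hinv K)
    refine ⟨_, h.congr' ?_⟩
    filter_upwards [eventually_le_atBot T] with τ hτ
    rw [min_eq_left hτ]
    ring
  refine ⟨ω, hω, ?_⟩
  have hlim : Tendsto (fun τ => W τ + (-K) * (-τ⁻¹)) atBot (nhds ω) := by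
    simpa only [add_zero] using hω.add (hinv (-K))
  obtain ⟨τ, hτK, hτT⟩ :=
    ((hgrow.eventually_gt_atTop K).and (eventually_le_atBot T)).exists
  have hle : W τ + (-K) * (-τ⁻¹) ≤ ω := by
    refine ge_of_tendsto hlim ?_
    filter_upwards [eventually_le_atBot τ] with y hy
    exact hanti (hy.trans hτT) hτT hy
  have hτ0 : 0 < -τ := by linarith
  have hpos : 0 < W τ - K / (-τ) := by
    rw [sub_pos, div_lt_iff₀ hτ0]
    linarith
  have heq : W τ + (-K) * (-τ⁻¹) = W τ - K / (-τ) := by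
    rw [div_neg, div_eq_mul_inv]
    ring
  linarith

/-- If `x' = y` and `y' = -2 x³ + r`, then the fourth root of the quartic oscillator energy
`y² + x⁴` changes at a rate at most half the forcing `|r|` divided by that fourth root. -/
theorem hasDerivAt_rpow_energy {x y : ℝ → ℝ} {r τ : ℝ} (hx : HasDerivAt x (y τ) τ)
    (hy : HasDerivAt y (-2 * x τ ^ 3 + r) τ) (hpos : 0 < y τ ^ 2 + x τ ^ 4) :
    ∃ d : ℝ, HasDerivAt (fun τ => (y τ ^ 2 + x τ ^ 4) ^ ((1:ℝ)/4)) d τ ∧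
      |d| * (2 * (y τ ^ 2 + x τ ^ 4) ^ ((1:ℝ)/4)) ≤ |r| := by
  have hE : HasDerivAt (fun τ => y τ ^ 2 + x τ ^ 4) (2 * y τ * r) τ := by
    refine ((hy.pow 2).add (hx.pow 4)).congr_deriv ?_
    push_cast
    ring
  refine ⟨_, hE.rpow_const (Or.inl hpos.ne'), ?_⟩
  set E := y τ ^ 2 + x τ ^ 4 with hEdef
  have hsqrt : E ^ ((1:ℝ)/4 - 1) * E ^ ((1:ℝ)/4) = (√E)⁻¹ := by
    rw [← Real.rpow_add hpos, Real.sqrt_eq_rpow, ← Real.rpow_neg hpos.le]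
    norm_num
  have hyE : |y τ| ≤ √E := Real.abs_le_sqrt (by nlinarith [sq_nonneg (x τ ^ 2)])
  have hspos : 0 < √E := Real.sqrt_pos.mpr hpos
  have hc : 0 ≤ E ^ ((1:ℝ)/4 - 1) := Real.rpow_nonneg hpos.le _
  calc |2 * y τ * r * (1 / 4) * E ^ ((1:ℝ)/4 - 1)| * (2 * E ^ ((1:ℝ)/4))
      = |y τ| * |r| * (E ^ ((1:ℝ)/4 - 1) * E ^ ((1:ℝ)/4)) := by
        rw [abs_mul, abs_mul, abs_mul, abs_mul, abs_of_nonneg hc, abs_two,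
          abs_of_pos (by norm_num : (0:ℝ) < 1 / 4)]
        ring
    _ = |r| * (|y τ| / √E) := by rw [hsqrt]; ring
    _ ≤ |r| * 1 := by gcongr; exact (div_le_one hspos).mpr hyE
    _ = |r| := mul_one _

theorem abs_le_rpow_energy (x y : ℝ) : |x| ≤ (y ^ 2 + x ^ 4) ^ ((1:ℝ)/4) := by
  have h : (|x| ^ 4) ^ ((1:ℝ)/4) = |x| := by
    simpa using Real.pow_rpow_inv_natCast (abs_nonneg x) (four_ne_zero)
  rw [← h]
  refine Real.rpow_le_rpow (by positivity) ?_ (by norm_num)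
  rw [(by decide : Even 4).pow_abs]
  nlinarith [sq_nonneg y]

/-- Let `ξ ≥ 0` and let `f` be a background solution of
`f'' + 2 f³ − (2ξ/(−τ)) f² = 0` on `(−∞,0)` such that `(−τ)·ω_s(τ) → +∞` as
`τ → −∞`, where `s(τ) = f(τ) − ξ/(−3τ)` and `ω_s(τ) = (s'(τ)² + s(τ)⁴)^{1/4}`.
Then the limit `ω := lim_{τ→−∞} ω_s(τ)` is strictly positive, and `s` is bounded
near `−∞`: there exists `τ* < 0` such that `|s(τ)| ≤ 2ω` for all `τ ≤ τ*`. -/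
theorem omega_positive_s_bounded
    (ξ : ℝ) (hξ0 : 0 ≤ ξ)
    (f f' f'' : ℝ → ℝ)
    (hf : ∀ τ < (0:ℝ), HasDerivAt f (f' τ) τ)
    (hf' : ∀ τ < (0:ℝ), HasDerivAt f' (f'' τ) τ)
    (hf''cont : ContinuousOn f'' (Set.Iio 0))
    (hode : ∀ τ < (0:ℝ), f'' τ + 2 * f τ ^ 3 - (2 * ξ / (-τ)) * f τ ^ 2 = 0)
    (hgrow : Tendsto
      (fun τ => (-τ) *
        (((f' τ - ξ / (3 * τ ^ 2)) ^ 2 + (f τ - ξ / (-3 * τ)) ^ 4) ^ ((1:ℝ)/4)))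
      atBot atTop) :
    ∃ ω : ℝ,
      Tendsto
        (fun τ => ((f' τ - ξ / (3 * τ ^ 2)) ^ 2 + (f τ - ξ / (-3 * τ)) ^ 4) ^ ((1:ℝ)/4))
        atBot (nhds ω) ∧
      0 < ω ∧
      ∃ τs < (0:ℝ), ∀ τ ≤ τs, |f τ - ξ / (-3 * τ)| ≤ 2 * ω := by
  have hx : ∀ τ < (0:ℝ), HasDerivAt (fun τ => f τ - ξ / (-3 * τ)) (f' τ - ξ / (3 * τ ^ 2)) τ := by
    intro τ hτ
    have h0 : -3 * τ ≠ 0 := by linarith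
    have hτ0 : τ ≠ 0 := hτ.ne
    refine ((hf τ hτ).sub ((hasDerivAt_const τ ξ).div ((hasDerivAt_id τ).const_mul (-3)) h0)
      ).congr_deriv ?_
    simp only [id]
    field_simp
    ring
  have hy : ∀ τ < (0:ℝ), HasDerivAt (fun τ => f' τ - ξ / (3 * τ ^ 2))
      (-2 * (f τ - ξ / (-3 * τ)) ^ 3 + (2 * ξ ^ 2 / 3 * (f τ - ξ / (-3 * τ)) / τ ^ 2 +
        (4 * ξ ^ 3 / 27 - 2 * ξ / 3) / (-τ) ^ 3)) τ := by
    intro τ hτ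
    have hτ0 : τ ≠ 0 := hτ.ne
    have h0 : 3 * τ ^ 2 ≠ 0 := by positivity
    have hf2 : f'' τ = -2 * f τ ^ 3 + (2 * ξ / (-τ)) * f τ ^ 2 := by linarith [hode τ hτ]
    refine ((hf' τ hτ).sub ((hasDerivAt_const τ ξ).div
      (((hasDerivAt_id τ).pow 2).const_mul 3) h0)).congr_deriv ?_
    simp only [id, hf2, Pi.pow_apply]
    field_simp
    ring
  set W : ℝ → ℝ :=
    fun τ => ((f' τ - ξ / (3 * τ ^ 2)) ^ 2 + (f τ - ξ / (-3 * τ)) ^ 4) ^ ((1:ℝ)/4) with hWdef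
  set A : ℝ := 2 * ξ ^ 2 / 3 with hA
  set B : ℝ := 4 * ξ ^ 3 / 27 - 2 * ξ / 3 with hB
  have hA0 : 0 ≤ A := by positivity
  have hsW : ∀ τ, |f τ - ξ / (-3 * τ)| ≤ W τ := fun τ => abs_le_rpow_energy _ _
  have hW0 : ∀ τ, 0 ≤ W τ := fun τ => (abs_nonneg _).trans (hsW τ)
  obtain ⟨T, hT⟩ := eventually_atBot.mp
    ((hgrow.eventually_ge_atTop 1).and (eventually_lt_atBot (0:ℝ)))
  have hkey : ∀ τ ≤ T, ∃ d, HasDerivAt W d τ ∧ |d| ≤ (A + |B|) / τ ^ 2 := by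
    intro τ hτ
    obtain ⟨h1, hτ0⟩ := hT τ hτ
    change 1 ≤ -τ * W τ at h1
    have hτ' : 0 < -τ := by linarith
    have hWpos : 0 < W τ := by
      by_contra hn
      nlinarith
    have hEpos : 0 < (f' τ - ξ / (3 * τ ^ 2)) ^ 2 + (f τ - ξ / (-3 * τ)) ^ 4 := by
      refine lt_of_le_of_ne (by positivity) fun h => hWpos.ne' ?_
      rw [hWdef]
      dsimp only
      rw [← h]
      exact Real.zero_rpow (by norm_num)
    obtain ⟨d, hd, hdle⟩ := hasDerivAt_rpow_energy
      (x := fun τ => f τ - ξ / (-3 * τ)) (y := fun τ => f' τ - ξ / (3 * τ ^ 2))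
      (hx τ hτ0) (hy τ hτ0) hEpos
    refine ⟨d, hd, ?_⟩
    change |d| * (2 * W τ) ≤ _ at hdle
    have hτ2 : 0 < τ ^ 2 := by nlinarith
    have hr : |A * (f τ - ξ / (-3 * τ)) / τ ^ 2 + B / (-τ) ^ 3| ≤
        (A + |B|) / τ ^ 2 * W τ := by
      have hfirst : |A * (f τ - ξ / (-3 * τ)) / τ ^ 2| ≤ A * W τ / τ ^ 2 := by
        rw [abs_div, abs_mul, abs_of_nonneg hA0, abs_of_pos hτ2]
        gcongr
        exact hsW τ
      have hsecond : |B / (-τ) ^ 3| ≤ |B| * W τ / τ ^ 2 := by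
        rw [abs_div, abs_of_pos (pow_pos hτ' 3), div_le_div_iff₀ (pow_pos hτ' 3) hτ2]
        have h2 : 0 ≤ |B| * τ ^ 2 := by positivity
        nlinarith [mul_le_mul_of_nonneg_left h1 h2]
      calc _ ≤ A * W τ / τ ^ 2 + |B| * W τ / τ ^ 2 :=
            (abs_add_le _ _).trans (add_le_add hfirst hsecond)
        _ = _ := by ring
    refine le_of_mul_le_mul_right ?_ hWpos
    nlinarith [mul_nonneg (abs_nonneg d) hWpos.le]
  have hW' : ∀ τ ≤ T, HasDerivAt W (deriv W τ) τ ∧ |deriv W τ| ≤ (A + |B|) / τ ^ 2 := by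
    intro τ hτ
    obtain ⟨d, hd, hle⟩ := hkey τ hτ
    rw [hd.deriv]
    exact ⟨hd, hle⟩
  obtain ⟨ω, hω, hωpos⟩ := exists_pos_tendsto_atBot_of_abs_deriv_le (hT T le_rfl).2
    (fun τ hτ => (hW' τ hτ).1) (fun τ hτ => (hW' τ hτ).2) hW0 hgrow
  refine ⟨ω, hω, hωpos, ?_⟩
  obtain ⟨S, hS⟩ := eventually_atBot.mp
    ((hω.eventually_le_const (by linarith : ω < 2 * ω)).and (eventually_lt_atBot (0:ℝ)))
  exact ⟨S, (hS S le_rfl).2, fun τ hτ => (hsW τ).trans (hS τ hτ).1⟩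
end

section
/- Let ξ ≥ 0 and let f : (−∞,0) → ℝ be a background solution such that (−τ)·ω_s(τ) → +∞ as τ → −∞, and let ω := lim_{τ→−∞} ω_s(τ) > 0. Then there exist a constant C > 0 and a time τ* < 0 such that |ω_s(τ) − ω| ≤ C·ξ²/(ω·τ²) for all τ ≤ τ*. -/
open Filter

lemma tendsto_inv_sq_atBot : Tendsto (fun x : ℝ => (x ^ 2)⁻¹) atBot (nhds 0) := by
  simpa using (tendsto_inv_atBot_zero (𝕜 := ℝ)).pow 2

/-- A function with a limit at `-∞` whose derivative is nonnegative on `(-∞, T]` is bounded below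
there by its limit. -/
lemma limit_atBot_le_of_hasDerivAt_nonneg {h h' : ℝ → ℝ} {T L : ℝ}
    (hh : ∀ x ≤ T, HasDerivAt h (h' x) x) (hnonneg : ∀ x ≤ T, 0 ≤ h' x)
    (hL : Tendsto h atBot (nhds L)) : ∀ x ≤ T, L ≤ h x := by
  have hmono : MonotoneOn h (Set.Iic T) :=
    monotoneOn_of_hasDerivWithinAt_nonneg (convex_Iic T)
      (fun x hx => (hh x hx).continuousAt.continuousWithinAt)
      (fun x hx => (hh x (interior_subset (s := Set.Iic T) hx)).hasDerivWithinAt)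
      (fun x hx => hnonneg x (interior_subset (s := Set.Iic T) hx))
  intro x hx
  refine le_of_tendsto hL ?_
  filter_upwards [eventually_le_atBot x] with y hy
  exact hmono (hy.trans hx) hx hy

/-- If `G' = O(τ⁻³)` with constant `K` on `(-∞, T]`, then `G` approaches its limit at `-∞` at rate
`K / (2 τ²)`. -/
lemma abs_sub_limit_le_of_hasDerivAt_div_cube {G H : ℝ → ℝ} {T K L : ℝ} (hT : T < 0)
    (hG : ∀ x ≤ T, HasDerivAt G (H x / x ^ 3) x) (hH : ∀ x ≤ T, |H x| ≤ K)
    (hL : Tendsto G atBot (nhds L)) : ∀ x ≤ T, |G x - L| ≤ K / (2 * x ^ 2) := by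
  have hq : ∀ x ≤ T, HasDerivAt (fun y : ℝ => K / 2 * (y ^ 2)⁻¹) (-K / x ^ 3) x := by
    intro x hx
    have hx0 : x ≠ 0 := by linarith
    refine (((hasDerivAt_pow 2 x).inv (pow_ne_zero 2 hx0)).const_mul (K / 2)).congr_deriv ?_
    field_simp
    norm_num
  have hq0 : Tendsto (fun y : ℝ => K / 2 * (y ^ 2)⁻¹) atBot (nhds 0) := by
    simpa using tendsto_inv_sq_atBot.const_mul (K / 2)
  have hlow := limit_atBot_le_of_hasDerivAt_nonneg (fun x hx => (hG x hx).add (hq x hx))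
    (fun x hx => by
      have h3 : x ^ 3 < 0 := Odd.pow_neg (by decide) (by linarith)
      rw [← add_div]
      exact div_nonneg_of_nonpos (by linarith [(abs_le.mp (hH x hx)).2]) h3.le)
    (hL.add hq0)
  have hupp := limit_atBot_le_of_hasDerivAt_nonneg (fun x hx => (hq x hx).sub (hG x hx))
    (fun x hx => by
      have h3 : x ^ 3 < 0 := Odd.pow_neg (by decide) (by linarith)
      rw [← sub_div]
      exact div_nonneg_of_nonpos (by linarith [(abs_le.mp (hH x hx)).1]) h3.le)
    (hq0.sub hL)
  intro x hx
  have h1 := hlow x hx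
  have h2 := hupp x hx
  have hK : K / (2 * x ^ 2) = K / 2 * (x ^ 2)⁻¹ := by
    rw [div_mul_eq_div_div, div_eq_mul_inv (K / 2)]
  simp only [Pi.add_apply, Pi.sub_apply] at h1 h2
  rw [hK, abs_le]
  constructor <;> linarith

/-- Energy balance for the shifted amplitude `s = f - ξ / (-3τ)`. -/
lemma hasDerivAt_modified_energy {ξ τ : ℝ} {f f' f'' : ℝ → ℝ} (hτ : τ < 0)
    (hf : HasDerivAt f (f' τ) τ) (hf' : HasDerivAt f' (f'' τ) τ)
    (hode : f'' τ + 2 * f τ ^ 3 - (2 * ξ / (-τ)) * f τ ^ 2 = 0) :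
    HasDerivAt
      (fun x => (f' x - ξ / (3 * x ^ 2)) ^ 2 + (f x - ξ / (-3 * x)) ^ 4
        - 2 * ξ ^ 2 / 3 * ((f x - ξ / (-3 * x)) ^ 2 * (x ^ 2)⁻¹))
      (ξ * ((4 / 3 - 8 * ξ ^ 2 / 27) * (f' τ - ξ / (3 * τ ^ 2))
        + 4 / 3 * ξ * (f τ - ξ / (-3 * τ)) ^ 2) / τ ^ 3) τ := by
  have h0 : τ ≠ 0 := hτ.ne
  have hx2 : HasDerivAt (fun x : ℝ => (x ^ 2)⁻¹) (-2 / τ ^ 3) τ := by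
    refine ((hasDerivAt_pow 2 τ).inv (pow_ne_zero 2 h0)).congr_deriv ?_
    field_simp
    norm_num [mul_comm]
  have hs : HasDerivAt (fun x => f x - ξ / (-3 * x)) (f' τ - ξ / (3 * τ ^ 2)) τ := by
    refine (hf.sub ((hasDerivAt_const τ ξ).div ((hasDerivAt_id τ).const_mul (-3))
      (by simpa using h0))).congr_deriv ?_
    simp only [id]
    field_simp
    ring
  have hs' : HasDerivAt (fun x => f' x - ξ / (3 * x ^ 2)) (f'' τ + 2 * ξ / (3 * τ ^ 3)) τ := by
    refine (hf'.sub ((hasDerivAt_const τ ξ).div ((hasDerivAt_pow 2 τ).const_mul 3)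
      (by simpa using h0))).congr_deriv ?_
    field_simp
    ring
  refine (((hs'.pow 2).add (hs.pow 4)).sub
    (((hs.pow 2).mul hx2).const_mul (2 * ξ ^ 2 / 3))).congr_deriv ?_
  have hf2 : f'' τ = -2 * f τ ^ 3 + (2 * ξ / (-τ)) * f τ ^ 2 := by linarith
  simp only [Pi.pow_apply, Nat.add_one_sub_one, pow_one, Nat.cast_ofNat]
  rw [hf2]
  field_simp
  ring

/-- Let `ξ ≥ 0` and let `f` be a background solution of
`f'' + 2 f³ − (2ξ/(−τ)) f² = 0` on `(−∞,0)` such that `(−τ)·ω_s(τ) → +∞` as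
`τ → −∞`, where `s(τ) = f(τ) − ξ/(−3τ)` and `ω_s(τ) = (s'(τ)² + s(τ)⁴)^{1/4}`,
and let `ω := lim_{τ→−∞} ω_s(τ) > 0`. Then there exist a constant `C > 0` and a
time `τ* < 0` such that `|ω_s(τ) − ω| ≤ C·ξ²/(ω·τ²)` for all `τ ≤ τ*`. -/
theorem omega_s_convergence_rate
    (ξ : ℝ) (hξ0 : 0 ≤ ξ)
    (f f' f'' : ℝ → ℝ)
    (hf : ∀ τ < (0:ℝ), HasDerivAt f (f' τ) τ)
    (hf' : ∀ τ < (0:ℝ), HasDerivAt f' (f'' τ) τ)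
    (hf''cont : ContinuousOn f'' (Set.Iio 0))
    (hode : ∀ τ < (0:ℝ), f'' τ + 2 * f τ ^ 3 - (2 * ξ / (-τ)) * f τ ^ 2 = 0)
    (hgrow : Tendsto
      (fun τ => (-τ) *
        (((f' τ - ξ / (3 * τ ^ 2)) ^ 2 + (f τ - ξ / (-3 * τ)) ^ 4) ^ ((1:ℝ)/4)))
      atBot atTop)
    (ω : ℝ) (hω : 0 < ω)
    (hlim : Tendsto
      (fun τ => ((f' τ - ξ / (3 * τ ^ 2)) ^ 2 + (f τ - ξ / (-3 * τ)) ^ 4) ^ ((1:ℝ)/4))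
      atBot (nhds ω)) :
    ∃ C > (0:ℝ), ∃ τs < (0:ℝ), ∀ τ ≤ τs,
      |(((f' τ - ξ / (3 * τ ^ 2)) ^ 2 + (f τ - ξ / (-3 * τ)) ^ 4) ^ ((1:ℝ)/4)) - ω|
        ≤ C * ξ ^ 2 / (ω * τ ^ 2) := by
  set E : ℝ → ℝ := fun τ => (f' τ - ξ / (3 * τ ^ 2)) ^ 2 + (f τ - ξ / (-3 * τ)) ^ 4 with hE
  set w : ℝ → ℝ := fun τ => E τ ^ ((1:ℝ)/4) with hw
  change Tendsto w atBot (nhds ω) at hlim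
  have hE0 : ∀ τ, 0 ≤ E τ := fun τ => by positivity
  have hw0 : ∀ τ, 0 ≤ w τ := fun τ => Real.rpow_nonneg (hE0 τ) _
  have hw4 : ∀ τ, w τ ^ 4 = E τ := fun τ => by
    rw [hw, ← Real.rpow_natCast, ← Real.rpow_mul (hE0 τ)]
    norm_num
  obtain ⟨T₀, hT₀⟩ := eventually_atBot.mp (hlim.eventually_lt_const (lt_add_one ω))
  obtain ⟨T, hTT₀, hT⟩ : ∃ T ≤ T₀, T < (0:ℝ) :=
    ⟨min T₀ (-1), min_le_left _ _, (min_le_right _ _).trans_lt (by norm_num)⟩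
  set B := ω + 1 with hB
  have hB0 : 0 < B := by positivity
  have hEB : ∀ τ ≤ T, E τ ≤ B ^ 4 := fun τ hτ => by
    rw [← hw4]
    exact pow_le_pow_left₀ (hw0 τ) (hT₀ τ (hτ.trans hTT₀)).le 4
  have hs : ∀ τ ≤ T, (f τ - ξ / (-3 * τ)) ^ 2 ≤ B ^ 2 := fun τ hτ => by
    refine (pow_le_pow_iff_left₀ (sq_nonneg _) (sq_nonneg B) two_ne_zero).mp ?_
    have := hEB τ hτ
    simp only [hE] at this
    nlinarith [sq_nonneg (f' τ - ξ / (3 * τ ^ 2))]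
  have hs' : ∀ τ ≤ T, |f' τ - ξ / (3 * τ ^ 2)| ≤ B ^ 2 := fun τ hτ => by
    refine abs_le_of_sq_le_sq ?_ (by positivity)
    have := hEB τ hτ
    simp only [hE] at this
    have : 0 ≤ (f τ - ξ / (-3 * τ)) ^ 4 := by positivity
    nlinarith
  set M := (4 / 3 + 8 * ξ ^ 2 / 27 + 4 / 3 * ξ) * B ^ 2 with hM
  have hM0 : 0 < M := by positivity
  have hH : ∀ τ ≤ T, |ξ * ((4 / 3 - 8 * ξ ^ 2 / 27) * (f' τ - ξ / (3 * τ ^ 2))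
      + 4 / 3 * ξ * (f τ - ξ / (-3 * τ)) ^ 2)| ≤ ξ * M := fun τ hτ => by
    rw [abs_mul, abs_of_nonneg hξ0]
    gcongr
    have hc : |4 / 3 - 8 * ξ ^ 2 / 27| ≤ 4 / 3 + 8 * ξ ^ 2 / 27 := by
      rw [abs_le]
      constructor <;> nlinarith [sq_nonneg ξ]
    calc _ ≤ |4 / 3 - 8 * ξ ^ 2 / 27| * |f' τ - ξ / (3 * τ ^ 2)|
          + 4 / 3 * ξ * (f τ - ξ / (-3 * τ)) ^ 2 := by
          refine (abs_add_le _ _).trans_eq ?_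
          rw [abs_mul, abs_of_nonneg (by positivity : 0 ≤ 4 / 3 * ξ * (f τ - ξ / (-3 * τ)) ^ 2)]
      _ ≤ (4 / 3 + 8 * ξ ^ 2 / 27) * B ^ 2 + 4 / 3 * ξ * B ^ 2 := by
          have h1 := hs' τ hτ
          have h2 := hs τ hτ
          exact add_le_add (mul_le_mul hc h1 (abs_nonneg _) (by positivity))
            (mul_le_mul_of_nonneg_left h2 (by positivity))
      _ = M := by rw [hM]; ring
  have hElim : Tendsto E atBot (nhds (ω ^ 4)) := (hlim.pow 4).congr hw4
  have hcorr : Tendsto (fun τ => 2 * ξ ^ 2 / 3 * ((f τ - ξ / (-3 * τ)) ^ 2 * (τ ^ 2)⁻¹))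
      atBot (nhds 0) := by
    have hinv : Tendsto (fun τ : ℝ => B ^ 2 * (τ ^ 2)⁻¹) atBot (nhds 0) := by
      simpa using tendsto_inv_sq_atBot.const_mul (B ^ 2)
    have : Tendsto (fun τ => (f τ - ξ / (-3 * τ)) ^ 2 * (τ ^ 2)⁻¹) atBot (nhds 0) := by
      refine squeeze_zero' (Eventually.of_forall fun τ => by positivity) ?_ hinv
      filter_upwards [eventually_le_atBot T] with τ hτ
      exact mul_le_mul_of_nonneg_right (hs τ hτ) (by positivity)
    simpa using this.const_mul (2 * ξ ^ 2 / 3)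
  have hrate := abs_sub_limit_le_of_hasDerivAt_div_cube hT
    (fun τ hτ => hasDerivAt_modified_energy (hτ.trans_lt hT) (hf τ (hτ.trans_lt hT))
      (hf' τ (hτ.trans_lt hT)) (hode τ (hτ.trans_lt hT))) hH (hElim.sub hcorr)
  have hErate : ∀ τ ≤ T, |E τ - ω ^ 4| ≤ ξ * (M / 2 + 2 * ξ / 3 * B ^ 2) / τ ^ 2 := by
    intro τ hτ
    have hτ0 : τ ≠ 0 := (hτ.trans_lt hT).ne
    have h1 := abs_le.mp (hrate τ hτ)
    have h2 : 2 * ξ ^ 2 / 3 * ((f τ - ξ / (-3 * τ)) ^ 2 * (τ ^ 2)⁻¹)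
        ≤ 2 * ξ ^ 2 / 3 * (B ^ 2 * (τ ^ 2)⁻¹) := by
      exact mul_le_mul_of_nonneg_left
        (mul_le_mul_of_nonneg_right (hs τ hτ) (by positivity)) (by positivity)
    have h3 : 0 ≤ 2 * ξ ^ 2 / 3 * ((f τ - ξ / (-3 * τ)) ^ 2 * (τ ^ 2)⁻¹) := by positivity
    have h4 : ξ * (M / 2 + 2 * ξ / 3 * B ^ 2) / τ ^ 2
        = ξ * M / (2 * τ ^ 2) + 2 * ξ ^ 2 / 3 * (B ^ 2 * (τ ^ 2)⁻¹) := by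
      field_simp
    rw [h4, abs_le]
    simp only [hE]
    constructor <;> linarith [h1.1, h1.2]
  have hwrate : ∀ τ, |w τ - ω| ≤ |E τ - ω ^ 4| / ω ^ 3 := by
    intro τ
    have hfac : E τ - ω ^ 4 = (w τ - ω) * (w τ ^ 3 + w τ ^ 2 * ω + w τ * ω ^ 2 + ω ^ 3) := by
      rw [← hw4]
      ring
    have hwτ := hw0 τ
    rw [le_div_iff₀ (by positivity), hfac, abs_mul]
    refine mul_le_mul_of_nonneg_left (le_trans ?_ (le_abs_self _)) (abs_nonneg _)
    have : 0 ≤ w τ ^ 3 + w τ ^ 2 * ω + w τ * ω ^ 2 := by positivity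
    linarith
  set D := M / 2 + 2 * ξ / 3 * B ^ 2 with hD
  have hD0 : 0 < D := by positivity
  have hmain : ∀ τ ≤ T, |w τ - ω| ≤ ξ * D / τ ^ 2 / ω ^ 3 := fun τ hτ =>
    (hwrate τ).trans (div_le_div_of_nonneg_right (hErate τ hτ) (by positivity))
  rcases hξ0.eq_or_lt with hξ | hξ
  · refine ⟨1, one_pos, T, hT, fun τ hτ => (hmain τ hτ).trans ?_⟩
    simp [← hξ]
  · refine ⟨D / (ξ * ω ^ 2), by positivity, T, hT, fun τ hτ => (hmain τ hτ).trans_eq ?_⟩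
    have hτ0 : τ ≠ 0 := (hτ.trans_lt hT).ne
    field_simp
end

section
/- A real 3×3 matrix M satisfies the isotropy condition — namely, for every R ∈ SO(3) there exists G ∈ SO(3) with M·R = G·M — if and only if M is isotropic, i.e. M = λ·O for some real number λ and some real orthogonal 3×3 matrix O. -/
open Matrix

/-- A real matrix whose Gram matrix is scalar is a multiple of an orthogonal matrix. -/
theorem exists_eq_smul_orthogonal_of_gram_eq_smul_one {n : Type*} [Fintype n] [DecidableEq n]
    {M : Matrix n n ℝ} {c : ℝ} (hc : 0 ≤ c) (h : Mᵀ * M = c • (1 : Matrix n n ℝ)) :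
    ∃ (l : ℝ) (O : Matrix n n ℝ), Oᵀ * O = 1 ∧ M = l • O := by
  rcases hc.eq_or_lt with rfl | hpos
  · refine ⟨0, 1, by simp, ?_⟩
    rw [zero_smul, ← conjTranspose_eq_transpose_of_trivial] at h
    rw [zero_smul, conjTranspose_mul_self_eq_zero.mp h]
  · have hs : √c ≠ 0 := (Real.sqrt_pos.mpr hpos).ne'
    refine ⟨√c, (√c)⁻¹ • M, ?_, by rw [smul_inv_smul₀ hs]⟩
    rw [transpose_smul, Matrix.smul_mul, Matrix.mul_smul, h, smul_smul, smul_smul, ← mul_inv,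
      Real.mul_self_sqrt hc, inv_mul_cancel₀ hpos.ne', one_smul]

/-- If `M * R = G * M` with `R` and `G` orthogonal, then `R` commutes with the Gram matrix
of `M`. -/
theorem gram_mul_eq_mul_gram {n : Type*} [Fintype n] [DecidableEq n]
    {M R G : Matrix n n ℝ} (hR : Rᵀ * R = 1) (hG : Gᵀ * G = 1) (h : M * R = G * M) :
    Mᵀ * M * R = R * (Mᵀ * M) := by
  have hinv : Rᵀ * (Mᵀ * M) * R = Mᵀ * M := by
    calc Rᵀ * (Mᵀ * M) * R = (M * R)ᵀ * (M * R) := by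
          rw [transpose_mul]; simp only [Matrix.mul_assoc]
      _ = Mᵀ * (Gᵀ * G) * M := by
          rw [h, transpose_mul]; simp only [Matrix.mul_assoc]
      _ = Mᵀ * M := by rw [hG, Matrix.mul_one]
  calc Mᵀ * M * R = R * Rᵀ * (Mᵀ * M * R) := by rw [mul_eq_one_comm.mp hR, Matrix.one_mul]
    _ = R * (Rᵀ * (Mᵀ * M) * R) := by simp only [Matrix.mul_assoc]
    _ = R * (Mᵀ * M) := by rw [hinv]

/-- A `3×3` matrix commuting with a half turn and with a cyclic permutation of the axes is
scalar. -/
theorem eq_smul_one_of_commute_halfTurn_cyclic {C : Matrix (Fin 3) (Fin 3) ℝ}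
    (hd : C * !![1, 0, 0; 0, -1, 0; 0, 0, -1] = !![1, 0, 0; 0, -1, 0; 0, 0, -1] * C)
    (hp : C * !![0, 0, 1; 1, 0, 0; 0, 1, 0] = !![0, 0, 1; 1, 0, 0; 0, 1, 0] * C) :
    C = C 0 0 • (1 : Matrix (Fin 3) (Fin 3) ℝ) := by
  have hd' := fun i j => congrFun (congrFun hd i) j
  have hp' := fun i j => congrFun (congrFun hp i) j
  simp only [Fin.forall_fin_succ, mul_apply, Fin.sum_univ_three] at hd' hp'
  simp at hd' hp'
  ext i j
  fin_cases i <;> fin_cases j <;> simp <;> grind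

/-- A real `3×3` matrix `M` satisfies the isotropy condition —
namely, for every `R ∈ SO(3)` there exists `G ∈ SO(3)` with `M·R = G·M` — if and
only if `M` is isotropic, i.e. `M = λ·O` for some real number `λ` and some real
orthogonal `3×3` matrix `O`. -/
theorem isotropy_condition_iff_isotropic
    (M : Matrix (Fin 3) (Fin 3) ℝ) :
    (∀ R : Matrix (Fin 3) (Fin 3) ℝ, Rᵀ * R = 1 → R.det = 1 →
      ∃ G : Matrix (Fin 3) (Fin 3) ℝ, Gᵀ * G = 1 ∧ G.det = 1 ∧ M * R = G * M) ↔
    (∃ (l : ℝ) (O : Matrix (Fin 3) (Fin 3) ℝ), Oᵀ * O = 1 ∧ M = l • O) := by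
  constructor
  · intro h
    have hcomm : ∀ R : Matrix (Fin 3) (Fin 3) ℝ, Rᵀ * R = 1 → R.det = 1 →
        Mᵀ * M * R = R * (Mᵀ * M) := fun R hR hdet =>
      let ⟨_, hG, _, hMR⟩ := h R hR hdet
      gram_mul_eq_mul_gram hR hG hMR
    have hC : Mᵀ * M = (Mᵀ * M) 0 0 • (1 : Matrix (Fin 3) (Fin 3) ℝ) := by
      refine eq_smul_one_of_commute_halfTurn_cyclic (hcomm _ ?_ ?_) (hcomm _ ?_ ?_)
      · ext i j
        fin_cases i <;> fin_cases j <;> simp [mul_apply, Fin.sum_univ_three]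
      · simp [det_fin_three]
      · ext i j
        fin_cases i <;> fin_cases j <;> simp [mul_apply, Fin.sum_univ_three]
      · simp [det_fin_three]
    refine exists_eq_smul_orthogonal_of_gram_eq_smul_one ?_ hC
    rw [mul_apply]
    exact Finset.sum_nonneg fun i _ => mul_self_nonneg (M i 0)
  · rintro ⟨l, O, hO, rfl⟩ R hR hdet
    have hOO : O * Oᵀ = 1 := mul_eq_one_comm.mp hO
    refine ⟨O * R * Oᵀ, ?_, ?_, ?_⟩
    · calc (O * R * Oᵀ)ᵀ * (O * R * Oᵀ) = O * (Rᵀ * (Oᵀ * O) * R) * Oᵀ := by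
            simp only [transpose_mul, transpose_transpose, Matrix.mul_assoc]
        _ = 1 := by rw [hO, Matrix.mul_one, hR, Matrix.mul_one, hOO]
    · rw [det_mul, det_mul, hdet, mul_one, ← det_mul, hOO, det_one]
    · rw [Matrix.smul_mul, Matrix.mul_smul, Matrix.mul_assoc (O * R), hO, Matrix.mul_one]
end

section
/- Let M and M' be real 3×3 matrices with I₂(M) = I₂(M'), I₃(M) = I₃(M'), and I₄(M) = I₄(M'). Then there exist G, R ∈ SO(3) such that M' = G·M·Rᵀ. Consequently, every scalar function φ on real 3×3 matrices that is invariant under left and right multiplication by SO(3) (i.e. φ(G·M·Rᵀ) = φ(M) for all G, R ∈ SO(3)) satisfies φ(M) = φ(M'); in other words, every such invariant scalar is a function of I₂, I₃ and I₄. -/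
open Matrix

/-- The squared Frobenius norm of a real `3×3` matrix. -/
def frobSq (M : Matrix (Fin 3) (Fin 3) ℝ) : ℝ := ∑ i, ∑ j, M i j ^ 2

/-- `I₂(M) = ‖M‖²` (squared Frobenius norm). -/
def I₂ (M : Matrix (Fin 3) (Fin 3) ℝ) : ℝ := frobSq M

/-- `I₃(M) = det M`. -/
def I₃ (M : Matrix (Fin 3) (Fin 3) ℝ) : ℝ := M.det

/-- `I₄(M) = ‖adj M‖²` (squared Frobenius norm of the adjugate). -/
def I₄ (M : Matrix (Fin 3) (Fin 3) ℝ) : ℝ := frobSq M.adjugate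

/-- Two real matrices with the same Gram matrix differ by an orthogonal factor on the left. -/
theorem exists_orthogonal_mul_eq_of_gram_eq {n : Type*} [Fintype n] [DecidableEq n]
    {A B : Matrix n n ℝ} (h : Aᵀ * A = Bᵀ * B) :
    ∃ U : Matrix n n ℝ, Uᵀ * U = 1 ∧ B = U * A := by
  let a : EuclideanSpace ℝ n →ₗ[ℝ] EuclideanSpace ℝ n := toEuclideanLin A
  let b : EuclideanSpace ℝ n →ₗ[ℝ] EuclideanSpace ℝ n := toEuclideanLin B
  have normSq (C : Matrix n n ℝ) (x : EuclideanSpace ℝ n) :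
      ‖toEuclideanLin C x‖ ^ 2 = x.ofLp ⬝ᵥ (Cᵀ * C) *ᵥ x.ofLp := by
    rw [← real_inner_self_eq_norm_sq, EuclideanSpace.inner_eq_star_dotProduct, toLpLin_apply,
      ← mulVec_mulVec, dotProduct_mulVec, vecMul_transpose]
    simp
  have norm_eq (x : EuclideanSpace ℝ n) : ‖b x‖ = ‖a x‖ := by
    rw [← sq_eq_sq₀ (norm_nonneg _) (norm_nonneg _), normSq, normSq, h]
  obtain ⟨g, hg⟩ := a.rangeRestrict.exists_rightInverse_of_surjective a.range_rangeRestrict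
  have a_g (y : a.range) : a (g y) = y := congrArg Subtype.val (LinearMap.congr_fun hg y)
  let L : a.range →ₗᵢ[ℝ] EuclideanSpace ℝ n :=
    ⟨b ∘ₗ g, fun y ↦ by rw [LinearMap.comp_apply, norm_eq, a_g, Submodule.coe_norm]⟩
  let E := L.extend.toLinearIsometryEquiv rfl
  have E_a (x : EuclideanSpace ℝ n) : E (a x) = b x := by
    have h₁ : E (a x) = b (g (a.rangeRestrict x)) := L.extend_apply (a.rangeRestrict x)
    rw [h₁, ← sub_eq_zero, ← map_sub, ← norm_eq_zero, norm_eq, map_sub, a_g]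
    simp
  let e := EuclideanSpace.basisFun n ℝ
  refine ⟨LinearMap.toMatrix e.toBasis e.toBasis E.toLinearMap, ?_, ?_⟩
  · have := mem_unitaryGroup_iff'.1 (E.toMatrix_mem_unitaryGroup e e)
    rwa [star_eq_conjTranspose, conjTranspose_eq_transpose_of_trivial] at this
  · have toMatrix_euclidean (C : Matrix n n ℝ) :
        LinearMap.toMatrix e.toBasis e.toBasis (toEuclideanLin C) = C := by
      ext i j
      simp [e, LinearMap.toMatrix_apply, toLpLin_apply]
    have hE : E.toLinearMap ∘ₗ a = b := LinearMap.ext E_a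
    rw [← toMatrix_euclidean B, ← toMatrix_euclidean A]
    change LinearMap.toMatrix _ _ b = _ * LinearMap.toMatrix _ _ a
    rw [← LinearMap.toMatrix_comp, hE]

/-- Real symmetric matrices with the same characteristic polynomial are orthogonally similar. -/
theorem exists_orthogonal_conj_of_charpoly_eq {n : Type*} [Fintype n] [DecidableEq n]
    {A B : Matrix n n ℝ} (hA : A.IsHermitian) (hB : B.IsHermitian)
    (h : A.charpoly = B.charpoly) :
    ∃ Q : Matrix n n ℝ, Qᵀ * Q = 1 ∧ B = Q * A * Qᵀ := by
  have hev := (IsHermitian.eigenvalues_eq_eigenvalues_iff hA hB).2 h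
  have hU := mem_unitaryGroup_iff'.1 hA.eigenvectorUnitary.2
  have hV := mem_unitaryGroup_iff'.1 hB.eigenvectorUnitary.2
  have hU' := mem_unitaryGroup_iff.1 hA.eigenvectorUnitary.2
  have hAs := hA.spectral_theorem
  have hBs := hB.spectral_theorem
  rw [Unitary.conjStarAlgAut_apply] at hAs hBs
  rw [hev] at hAs
  simp only [star_eq_conjTranspose, conjTranspose_eq_transpose_of_trivial] at hU hV hU' hAs hBs
  set U : Matrix n n ℝ := hA.eigenvectorUnitary.1
  set V : Matrix n n ℝ := hB.eigenvectorUnitary.1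
  set D : Matrix n n ℝ := diagonal (RCLike.ofReal ∘ hB.eigenvalues)
  refine ⟨V * Uᵀ, ?_, ?_⟩
  · calc (V * Uᵀ)ᵀ * (V * Uᵀ) = U * (Vᵀ * V) * Uᵀ := by
          simp only [transpose_mul, transpose_transpose, Matrix.mul_assoc]
      _ = 1 := by rw [hV, Matrix.mul_one, hU']
  · calc B = V * D * Vᵀ := hBs
      _ = V * (Uᵀ * U) * D * (Uᵀ * U) * Vᵀ := by simp only [hU, Matrix.mul_one]
      _ = V * Uᵀ * (U * D * Uᵀ) * (V * Uᵀ)ᵀ := by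
          simp only [transpose_mul, transpose_transpose, Matrix.mul_assoc]
      _ = V * Uᵀ * A * (V * Uᵀ)ᵀ := by rw [← hAs]

theorem det_eq_one_or_neg_one_of_orthogonal {n : Type*} [Fintype n] [DecidableEq n]
    {U : Matrix n n ℝ} (hU : Uᵀ * U = 1) : U.det = 1 ∨ U.det = -1 := by
  have h := congrArg det hU
  rw [det_mul, det_transpose, det_one] at h
  exact mul_self_eq_one_iff.1 h

/-- A singular real matrix is fixed on the left by an orthogonal matrix of determinant `-1`,
namely the reflection in the orthogonal complement of a left null vector. -/
theorem exists_orthogonal_det_neg_one_mul_eq_self {n : Type*} [Fintype n] [DecidableEq n]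
    {N : Matrix n n ℝ} (hN : N.det = 0) :
    ∃ H : Matrix n n ℝ, Hᵀ * H = 1 ∧ H.det = -1 ∧ H * N = N := by
  obtain ⟨v, hv, hvN⟩ := exists_vecMul_eq_zero_iff.2 hN
  have hd : v ⬝ᵥ v ≠ 0 := fun h ↦ hv (dotProduct_self_eq_zero.1 h)
  have hP : vecMulVec v v * vecMulVec v v = (v ⬝ᵥ v) • vecMulVec v v := by
    rw [vecMulVec_mul_vecMulVec]
    ext i j
    simp [vecMulVec_apply]
    ring
  set c : ℝ := 2 / (v ⬝ᵥ v)
  have hc : c * (v ⬝ᵥ v) = 2 := div_mul_cancel₀ _ hd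
  refine ⟨1 - c • vecMulVec v v, ?_, ?_, ?_⟩
  · rw [transpose_sub, transpose_one, transpose_smul, transpose_vecMulVec]
    simp only [Matrix.sub_mul, Matrix.mul_sub, Matrix.one_mul, Matrix.mul_one, smul_mul,
      Matrix.mul_smul, hP, smul_smul, hc]
    module
  · have := det_one_sub_mul_comm (replicateCol Unit (c • v)) (replicateRow Unit v)
    rw [← vecMulVec_eq, smul_vecMulVec] at this
    rw [this]
    simp [replicateRow_mul_replicateCol_apply, hc]
    norm_num
  · rw [Matrix.sub_mul, Matrix.one_mul, smul_mul, vecMulVec_mul, hvN]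
    simp

/-- Two real matrices with the same Gram matrix and the same determinant differ by a rotation on
the left. -/
theorem exists_rotation_mul_eq_of_gram_eq {n : Type*} [Fintype n] [DecidableEq n]
    {A B : Matrix n n ℝ} (h : Aᵀ * A = Bᵀ * B) (hdet : A.det = B.det) :
    ∃ U : Matrix n n ℝ, Uᵀ * U = 1 ∧ U.det = 1 ∧ B = U * A := by
  obtain ⟨U, hU, hB⟩ := exists_orthogonal_mul_eq_of_gram_eq h
  rcases det_eq_one_or_neg_one_of_orthogonal hU with h1 | h1
  · exact ⟨U, hU, h1, hB⟩
  have hA : A.det = 0 := by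
    rw [hB, det_mul, h1] at hdet
    linarith
  obtain ⟨H, hH, hHdet, hHA⟩ := exists_orthogonal_det_neg_one_mul_eq_self hA
  refine ⟨U * H, ?_, by rw [det_mul, h1, hHdet]; norm_num, by rw [Matrix.mul_assoc, hHA, hB]⟩
  rw [transpose_mul, Matrix.mul_assoc, ← Matrix.mul_assoc Uᵀ, hU, Matrix.one_mul, hH]

theorem charpoly_fin_three {R : Type*} [CommRing R] (A : Matrix (Fin 3) (Fin 3) R) :
    A.charpoly = .X ^ 3 - .C A.trace * .X ^ 2 + .C A.adjugate.trace * .X - .C A.det := by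
  simp only [charpoly, det_fin_three, trace_fin_three, adjugate_fin_three, charmatrix_apply,
    of_apply, cons_val', cons_val, diagonal_apply, map_add, map_sub, map_mul]
  simp
  ring

theorem trace_transpose_mul_self (M : Matrix (Fin 3) (Fin 3) ℝ) :
    (Mᵀ * M).trace = frobSq M := by
  rw [frobSq, Finset.sum_comm]
  simp [trace, mul_apply, sq]

theorem trace_adjugate_transpose_mul_self (M : Matrix (Fin 3) (Fin 3) ℝ) :
    (Mᵀ * M).adjugate.trace = frobSq M.adjugate := by
  rw [adjugate_mul_distrib, ← adjugate_transpose, trace_mul_comm, trace_transpose_mul_self]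

/-- **completeness of the invariant scalars.** Let `M` and `M'` be real
`3×3` matrices with `I₂(M) = I₂(M')`, `I₃(M) = I₃(M')`, and `I₄(M) = I₄(M')`. Then
there exist `G, R ∈ SO(3)` such that `M' = G·M·Rᵀ`. Consequently, every scalar
function `φ` on real `3×3` matrices that is invariant under left and right
multiplication by `SO(3)` satisfies `φ(M) = φ(M')`; in other words, every such
invariant scalar is a function of `I₂`, `I₃` and `I₄`. -/
theorem invariant_scalars_complete
    (M M' : Matrix (Fin 3) (Fin 3) ℝ)
    (h2 : I₂ M = I₂ M') (h3 : I₃ M = I₃ M') (h4 : I₄ M = I₄ M') :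
    (∃ G R : Matrix (Fin 3) (Fin 3) ℝ,
      Gᵀ * G = 1 ∧ G.det = 1 ∧ Rᵀ * R = 1 ∧ R.det = 1 ∧
      M' = G * M * Rᵀ) ∧
    (∀ φ : Matrix (Fin 3) (Fin 3) ℝ → ℝ,
      (∀ (A G R : Matrix (Fin 3) (Fin 3) ℝ),
        Gᵀ * G = 1 → G.det = 1 → Rᵀ * R = 1 → R.det = 1 →
        φ (G * A * Rᵀ) = φ A) →
      φ M = φ M') := by
  have key : ∃ G R : Matrix (Fin 3) (Fin 3) ℝ,
      Gᵀ * G = 1 ∧ G.det = 1 ∧ Rᵀ * R = 1 ∧ R.det = 1 ∧ M' = G * M * Rᵀ := by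
    have hchar : (Mᵀ * M).charpoly = (M'ᵀ * M').charpoly := by
      simp only [I₂, I₃, I₄] at h2 h3 h4
      simp only [charpoly_fin_three, trace_transpose_mul_self, trace_adjugate_transpose_mul_self,
        det_mul, det_transpose, h2, h3, h4]
    obtain ⟨R, hR, hRdet, hconj⟩ : ∃ R : Matrix (Fin 3) (Fin 3) ℝ,
        Rᵀ * R = 1 ∧ R.det = 1 ∧ M'ᵀ * M' = R * (Mᵀ * M) * Rᵀ := by
      obtain ⟨Q, hQ, hconj⟩ := exists_orthogonal_conj_of_charpoly_eq
        (isHermitian_conjTranspose_mul_self M) (isHermitian_conjTranspose_mul_self M') hchar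
      rcases det_eq_one_or_neg_one_of_orthogonal hQ with h | h
      · exact ⟨Q, hQ, h, hconj⟩
      · exact ⟨-Q, by simpa using hQ, by rw [det_neg, h]; norm_num, by simpa using hconj⟩
    have hgram : (M * Rᵀ)ᵀ * (M * Rᵀ) = M'ᵀ * M' := by
      rw [hconj]
      simp only [transpose_mul, transpose_transpose, Matrix.mul_assoc]
    have hdet : (M * Rᵀ).det = M'.det := by
      rw [det_mul, det_transpose, hRdet, mul_one]
      exact h3
    obtain ⟨G, hG, hGdet, hM'⟩ := exists_rotation_mul_eq_of_gram_eq hgram hdet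
    exact ⟨G, R, hG, hGdet, hR, hRdet, by rw [hM', Matrix.mul_assoc]⟩
  refine ⟨key, fun φ hφ ↦ ?_⟩
  obtain ⟨G, R, hG, hGdet, hR, hRdet, hM'⟩ := key
  rw [hM', hφ M G R hG hGdet hR hRdet]
end

section
/- For every real 3×3 matrix M one has I₂(M)² ≥ 3·I₄(M), i.e. ‖M‖⁴ ≥ 3·‖adj M‖², with equality if and only if M is isotropic, i.e. M = λ·O for some real number λ and some real orthogonal 3×3 matrix O. -/
open Matrix

/-- `M` is isotropic if it is a real scalar multiple of an orthogonal matrix. -/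
def IsIsotropic (M : Matrix (Fin 3) (Fin 3) ℝ) : Prop :=
  ∃ (l : ℝ) (O : Matrix (Fin 3) (Fin 3) ℝ), Oᵀ * O = 1 ∧ M = l • O

theorem frobSq_nonneg (M : Matrix (Fin 3) (Fin 3) ℝ) : 0 ≤ frobSq M := by
  unfold frobSq
  positivity

theorem frobSq_eq_zero_iff {M : Matrix (Fin 3) (Fin 3) ℝ} : frobSq M = 0 ↔ M = 0 := by
  refine ⟨fun h => ?_, fun h => by simp [frobSq, h]⟩
  ext i j
  have hi := (Finset.sum_eq_zero_iff_of_nonneg fun i _ =>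
    Finset.sum_nonneg fun j _ => sq_nonneg (M i j)).1 h i (Finset.mem_univ i)
  have hij := (Finset.sum_eq_zero_iff_of_nonneg fun j _ => sq_nonneg (M i j)).1 hi j
    (Finset.mem_univ j)
  simpa using hij

/-- The defect `I₂² - 3 I₄` is a multiple of the squared norm of the deviatoric part of `Mᵀ M`. -/
theorem I₂_sq_sub_three_mul_I₄ (M : Matrix (Fin 3) (Fin 3) ℝ) :
    I₂ M ^ 2 - 3 * I₄ M = 3 / 2 * frobSq (Mᵀ * M - (I₂ M / 3) • 1) := by
  simp [I₂, I₄, frobSq, adjugate_fin_three, Fin.sum_univ_three, mul_apply, one_apply]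
  ring

theorem isIsotropic_iff_transpose_mul_self (M : Matrix (Fin 3) (Fin 3) ℝ) :
    IsIsotropic M ↔ Mᵀ * M = (I₂ M / 3) • 1 := by
  constructor
  · rintro ⟨l, O, hO, rfl⟩
    have hI : I₂ (l • O) = l ^ 2 * (Oᵀ * O).trace := by
      simp [I₂, frobSq, trace, Fin.sum_univ_three, mul_apply]
      ring
    rw [hI, hO, transpose_smul, smul_mul_smul_comm, hO]
    congr 1
    simp
    ring
  · intro h
    have hI : 0 ≤ I₂ M := frobSq_nonneg M
    rcases hI.eq_or_lt with h0 | hpos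
    · exact ⟨0, 1, by simp, by simpa using frobSq_eq_zero_iff.1 h0.symm⟩
    · have hl : 0 < √(I₂ M / 3) := Real.sqrt_pos.2 (by positivity)
      refine ⟨√(I₂ M / 3), (√(I₂ M / 3))⁻¹ • M, ?_, (smul_inv_smul₀ hl.ne' M).symm⟩
      rw [transpose_smul, smul_mul_smul_comm, h, smul_smul, ← mul_inv,
        Real.mul_self_sqrt (by positivity), inv_mul_cancel₀ (by positivity), one_smul]

/-- For every real `3×3` matrix `M` one has `I₂(M)² ≥ 3·I₄(M)`,
i.e. `‖M‖⁴ ≥ 3·‖adj M‖²`, with equality if and only if `M` is isotropic, i.e.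
`M = λ·O` for some real `λ` and real orthogonal `O`. -/
theorem I2_sq_ge_three_I4
    (M : Matrix (Fin 3) (Fin 3) ℝ) :
    3 * I₄ M ≤ (I₂ M) ^ 2 ∧ ((I₂ M) ^ 2 = 3 * I₄ M ↔ IsIsotropic M) := by
  have hM := I₂_sq_sub_three_mul_I₄ M
  have hnonneg := frobSq_nonneg (Mᵀ * M - (I₂ M / 3) • 1)
  refine ⟨by linarith, ?_⟩
  rw [isIsotropic_iff_transpose_mul_self, ← sub_eq_zero, hM, ← sub_eq_zero (a := Mᵀ * M),
    ← frobSq_eq_zero_iff]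
  simp
end

section
/- Let M be a real 3×3 matrix whose adjugate adj M is a real scization multiple of an orthogonal matrix, i.e. adj M = μ·O for some real μ and some real orthogonal 3×3 matrix O. Then I₄(M)² = 3·I₂(M)·I₃(M)², i.e. ‖adj M‖⁴ = 3·‖M‖²·(det M)². -/
open Matrix

theorem frobSq_eq_trace (M : Matrix (Fin 3) (Fin 3) ℝ) : frobSq M = (Mᵀ * M).trace := by
  simp only [frobSq, trace, diag, mul_apply, transpose_apply, ← sq]
  exact Finset.sum_comm

theorem frobSq_smul (c : ℝ) (M : Matrix (Fin 3) (Fin 3) ℝ) :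
    frobSq (c • M) = c ^ 2 * frobSq M := by
  simp only [frobSq, Matrix.smul_apply, smul_eq_mul, mul_pow, Finset.mul_sum]

theorem frobSq_of_transpose_mul_self {O : Matrix (Fin 3) (Fin 3) ℝ} (hO : Oᵀ * O = 1) :
    frobSq O = 3 := by
  simp [frobSq_eq_trace, hO]

/-- If `adj M = μ • O` with `O` orthogonal, then `μ • M = det M • Oᵀ`. -/
theorem smul_eq_det_smul_transpose {M O : Matrix (Fin 3) (Fin 3) ℝ} {μ : ℝ}
    (hO : Oᵀ * O = 1) (hadj : M.adjugate = μ • O) : μ • M = M.det • Oᵀ := by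
  have h : M * (μ • O) = M.det • 1 := hadj ▸ M.mul_adjugate
  calc μ • M = M * (μ • O) * Oᵀ := by
        rw [Matrix.mul_smul, Matrix.smul_mul, Matrix.mul_assoc, mul_eq_one_comm.mp hO, Matrix.mul_one]
    _ = M.det • Oᵀ := by rw [h, Matrix.smul_mul, Matrix.one_mul]

/-- Let `M` be a real `3×3` matrix whose adjugate `adj M` is a
real scalar multiple of an orthogonal matrix, i.e. `adj M = μ·O` for some real `μ`
and some real orthogonal `3×3` matrix `O`. Then `I₄(M)² = 3·I₂(M)·I₃(M)²`, i.e.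
`‖adj M‖⁴ = 3·‖M‖²·(det M)²`. -/
theorem adjugate_isotropic_relation
    (M : Matrix (Fin 3) (Fin 3) ℝ)
    (μ : ℝ) (O : Matrix (Fin 3) (Fin 3) ℝ)
    (hO : Oᵀ * O = 1) (hadj : M.adjugate = μ • O) :
    (I₄ M) ^ 2 = 3 * I₂ M * (I₃ M) ^ 2 := by
  have hOT : Oᵀᵀ * Oᵀ = 1 := by rw [transpose_transpose, mul_eq_one_comm.mp hO]
  have h4 : I₄ M = μ ^ 2 * 3 := by
    rw [I₄, hadj, frobSq_smul, frobSq_of_transpose_mul_self hO]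
  have h2 : μ ^ 2 * I₂ M = I₃ M ^ 2 * 3 := by
    rw [I₂, I₃, ← frobSq_smul, smul_eq_det_smul_transpose hO hadj, frobSq_smul,
      frobSq_of_transpose_mul_self hOT]
  have hd : I₃ M ^ 2 = μ ^ 3 * O.det := by
    have h := M.det_adjugate
    rw [hadj, det_smul] at h
    simpa [I₃] using h.symm
  have hdO : O.det ^ 2 = 1 := by
    have h := congrArg det hO
    rwa [det_mul, det_transpose, det_one, ← sq] at h
  rcases eq_or_ne μ 0 with rfl | hμ
  · have h3 : I₃ M ^ 2 = 0 := by simpa using hd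
    rw [h4, h3]
    ring
  · apply mul_left_cancel₀ (pow_ne_zero 2 hμ)
    calc μ ^ 2 * I₄ M ^ 2 = 9 * (μ ^ 6 * O.det ^ 2) := by rw [h4, hdO]; ring
      _ = 9 * (I₃ M ^ 2) ^ 2 := by rw [hd]; ring
      _ = μ ^ 2 * (3 * I₂ M * I₃ M ^ 2) := by linear_combination -3 * I₃ M ^ 2 * h2
end

section
/- Let M be a real 3×3 matrix satisfying I₄(M)² − 3·I₂(M)·I₃(M)² = 0. Then I₄(M)·(I₂(M)² − 3·I₄(M)) = 0. -/
open Matrix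

theorem frobSq_eq_trace_mul_transpose (M : Matrix (Fin 3) (Fin 3) ℝ) :
    frobSq M = (M * Mᵀ).trace := by
  simp only [frobSq, trace, diag_apply, mul_apply, transpose_apply, sq]

theorem frobSq_adjugate (M : Matrix (Fin 3) (Fin 3) ℝ) :
    frobSq M.adjugate = (M * Mᵀ).adjugate.trace := by
  rw [frobSq_eq_trace_mul_transpose, adjugate_mul_distrib, ← adjugate_transpose, trace_mul_comm]

/-- A symmetric `3×3` matrix whose first two invariants satisfy `(tr A)² = 3 tr (adj A)` is
scalar. -/
theorem Matrix.IsSymm.eq_smul_one_of_trace_sq_eq {A : Matrix (Fin 3) (Fin 3) ℝ} (hA : A.IsSymm)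
    (h : A.trace ^ 2 = 3 * A.adjugate.trace) : A = A 0 0 • (1 : Matrix (Fin 3) (Fin 3) ℝ) := by
  have h01 := hA.apply 0 1
  have h02 := hA.apply 0 2
  have h12 := hA.apply 1 2
  simp only [trace_fin_three, adjugate_fin_three, of_apply, cons_val', cons_val_zero, cons_val_one,
    cons_val, h01, h02, h12] at h
  have key : (A 0 0 - A 1 1) ^ 2 + (A 0 0 - A 2 2) ^ 2 + (A 1 1 - A 2 2) ^ 2
      + 6 * (A 0 1 ^ 2 + A 0 2 ^ 2 + A 1 2 ^ 2) = 0 := by linear_combination 2 * h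
  have sq₁ := sq_nonneg (A 0 0 - A 1 1)
  have sq₂ := sq_nonneg (A 0 0 - A 2 2)
  have sq₃ := sq_nonneg (A 1 1 - A 2 2)
  have sq₄ := sq_nonneg (A 0 1)
  have sq₅ := sq_nonneg (A 0 2)
  have sq₆ := sq_nonneg (A 1 2)
  have d₁ : A 0 0 - A 1 1 = 0 := pow_eq_zero_iff two_ne_zero |>.mp (by linarith)
  have d₂ : A 0 0 - A 2 2 = 0 := pow_eq_zero_iff two_ne_zero |>.mp (by linarith)
  have o₁ : A 0 1 = 0 := pow_eq_zero_iff two_ne_zero |>.mp (by linarith)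
  have o₂ : A 0 2 = 0 := pow_eq_zero_iff two_ne_zero |>.mp (by linarith)
  have o₃ : A 1 2 = 0 := pow_eq_zero_iff two_ne_zero |>.mp (by linarith)
  ext i j
  fin_cases i <;> fin_cases j <;> simp <;> linarith

/-- Let `M` be a real `3×3` matrix satisfying
`I₄(M)² − 3·I₂(M)·I₃(M)² = 0`. Then `I₄(M)·(I₂(M)² − 3·I₄(M)) = 0`. -/
theorem isotropic_relation_rewrite
    (M : Matrix (Fin 3) (Fin 3) ℝ)
    (h : (I₄ M) ^ 2 - 3 * I₂ M * (I₃ M) ^ 2 = 0) :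
    I₄ M * ((I₂ M) ^ 2 - 3 * I₄ M) = 0 := by
  have hdet : (M * Mᵀ).det = I₃ M ^ 2 := by rw [det_mul, det_transpose, I₃, sq]
  rw [← hdet] at h
  simp only [I₂, I₄, frobSq_adjugate, frobSq_eq_trace_mul_transpose M] at h ⊢
  have hS : (M * Mᵀ).IsSymm := isSymm_mul_transpose_self M
  generalize M * Mᵀ = S at h hS ⊢
  have hadj : S.adjugate.adjugate.trace = S.det * S.trace := by
    rw [adjugate_adjugate S (by simp)]
    simp
  have hA : S.adjugate = S.adjugate 0 0 • (1 : Matrix (Fin 3) (Fin 3) ℝ) :=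
    IsSymm.eq_smul_one_of_trace_sq_eq (by rw [IsSymm, adjugate_transpose, hS])
      (by rw [hadj]; linear_combination h)
  generalize S.adjugate 0 0 = x at hA
  rcases eq_or_ne x 0 with rfl | hx
  · simp [hA]
  · have hxS : x • S = S.det • (1 : Matrix (Fin 3) (Fin 3) ℝ) := by
      rw [← mul_adjugate, hA, mul_smul_comm, mul_one]
    have hSs : S = (x⁻¹ * S.det) • (1 : Matrix (Fin 3) (Fin 3) ℝ) := by
      rw [mul_smul, ← hxS, inv_smul_smul₀ hx]
    generalize x⁻¹ * S.det = s at hSs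
    rw [hSs, adjugate_smul]
    simp
    ring_nf
    simp
end

section
/- Let M be a real 3×3 matrix whose adjugate adj M is a real scalar multiple of an orthogonal matrix. Then either M is isotropic (M = λ·O for some real λ and real orthogonal O), or M has rank at most 1. -/
open Matrix

theorem mul_eq_mul_of_adjugate_eq_zero {R : Type*} [CommRing R] (M : Matrix (Fin 3) (Fin 3) R)
    (h : M.adjugate = 0) (i j k l : Fin 3) : M i j * M k l = M i l * M k j := by
  have hentry (a b : Fin 3) : M.adjugate a b = 0 := by simp [h]
  simp only [adjugate_fin_three, Fin.forall_fin_succ, of_apply, cons_val', cons_val_zero,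
    cons_val_succ, cons_val_fin_one, IsEmpty.forall_iff, and_true] at hentry
  have hlt : ∀ i k : Fin 3, i < k → ∀ j l : Fin 3, j < l → M i j * M k l = M i l * M k j := by
    simp [Fin.forall_fin_succ]
    grind
  rcases lt_trichotomy i k with hik | rfl | hik
  · rcases lt_trichotomy j l with hjl | rfl | hjl
    · exact hlt i k hik j l hjl
    · rfl
    · exact (hlt i k hik l j hjl).symm
  · exact mul_comm _ _
  · rcases lt_trichotomy j l with hjl | rfl | hjl
    · linear_combination -hlt k i hik j l hjl
    · rfl
    · linear_combination hlt k i hik l j hjl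

theorem rank_le_one_of_adjugate_eq_zero {K : Type*} [Field K] (M : Matrix (Fin 3) (Fin 3) K)
    (h : M.adjugate = 0) : M.rank ≤ 1 := by
  by_cases hM : M = 0
  · simp [hM]
  · obtain ⟨i, j, hij⟩ : ∃ i j, M i j ≠ 0 := by
      by_contra! hzero
      exact hM (Matrix.ext hzero)
    have hrow : M = vecMulVec (fun k => M k j) (fun l => (M i j)⁻¹ * M i l) := by
      ext k l
      have hminor := mul_eq_mul_of_adjugate_eq_zero M h i j k l
      rw [vecMulVec_apply]
      field_simp
      linear_combination hminor
    rw [hrow]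
    exact rank_vecMulVec_le _ _

/-- Let `M` be a real `3×3` matrix whose adjugate `adj M` is a
real scalar multiple of an orthogonal matrix. Then either `M` is isotropic
(`M = λ·O` for some real `λ` and real orthogonal `O`), or `M` has rank at most 1. -/
theorem adjugate_isotropic_dichotomy
    (M : Matrix (Fin 3) (Fin 3) ℝ)
    (μ : ℝ) (O : Matrix (Fin 3) (Fin 3) ℝ)
    (hO : Oᵀ * O = 1) (hadj : M.adjugate = μ • O) :
    IsIsotropic M ∨ M.rank ≤ 1 := by
  rcases eq_or_ne μ 0 with rfl | hμ
  · exact Or.inr (rank_le_one_of_adjugate_eq_zero M (by rw [hadj, zero_smul]))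
  · refine Or.inl ⟨μ⁻¹ * M.det, Oᵀ, ?_, ?_⟩
    · rw [transpose_transpose]
      exact mul_eq_one_comm.mp hO
    · have h : μ • (M * O) = M.det • (1 : Matrix (Fin 3) (Fin 3) ℝ) := by
        rw [← mul_adjugate, hadj, mul_smul_comm]
      calc M = M * (O * Oᵀ) := by rw [mul_eq_one_comm.mp hO, mul_one]
        _ = μ⁻¹ • (μ • (M * O)) * Oᵀ := by rw [inv_smul_smul₀ hμ, mul_assoc]
        _ = (μ⁻¹ * M.det) • Oᵀ := by rw [h, smul_smul, smul_mul_assoc, one_mul]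
end

section
/- Let I ⊆ ℝ be an open interval and A : I → M₃(ℝ) a continuously differentiable matrix-valued function such that for every τ ∈ I both A(τ) and A'(τ) are real scalar multiples of orthogonal matrices, and A(τ) ≠ 0 for all τ ∈ I. Then there exist a single real orthogonal 3×3 matrix S and a function f : I → ℝ, nowhere zero on I, such that A(τ) = f(τ)·S for all τ ∈ I. -/
open Matrix

/-- A real `3×3` matrix that is both conformal and the sum of a scalar and a skew-symmetric
matrix is scalar. -/
theorem eq_smul_one_of_add_transpose_of_transpose_mul_self
    {B : Matrix (Fin 3) (Fin 3) ℝ} {s m : ℝ}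
    (hsym : Bᵀ + B = s • (1 : Matrix (Fin 3) (Fin 3) ℝ))
    (hconf : Bᵀ * B = m • (1 : Matrix (Fin 3) (Fin 3) ℝ)) :
    B = (s / 2) • (1 : Matrix (Fin 3) (Fin 3) ℝ) := by
  have hs := fun i j => congrFun (congrFun hsym i) j
  have hm := fun i j => congrFun (congrFun hconf i) j
  simp only [Matrix.add_apply, transpose_apply, Matrix.smul_apply, one_apply, smul_eq_mul,
    mul_apply, Fin.sum_univ_three] at hs hm
  have s00 := hs 0 0
  have s11 := hs 1 1
  have s22 := hs 2 2
  have s01 := hs 0 1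
  have s02 := hs 0 2
  have s12 := hs 1 2
  have m00 := hm 0 0
  have m11 := hm 1 1
  have m22 := hm 2 2
  have m01 := hm 0 1
  have m02 := hm 0 2
  simp only [Fin.reduceEq, ↓reduceIte, mul_one, mul_zero]
    at s00 s11 s22 s01 s02 s12 m00 m11 m22 m01 m02
  have e00 : B 0 0 = s / 2 := by linarith
  have e11 : B 1 1 = s / 2 := by linarith
  have e22 : B 2 2 = s / 2 := by linarith
  have e10 : B 1 0 = -B 0 1 := by linarith
  have e20 : B 2 0 = -B 0 2 := by linarith
  have e21 : B 2 1 = -B 1 2 := by linarith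
  rw [e00, e10, e20] at m00 m01 m02
  rw [e11, e21] at m01 m11
  rw [e22] at m22 m02
  have h1 : B 0 2 * B 1 2 = 0 := by linarith
  have h2 : B 0 2 ^ 2 = B 1 2 ^ 2 := by linarith
  have h3 : B 0 1 ^ 2 = B 0 2 ^ 2 := by linarith
  have z02 : B 0 2 = 0 := by
    rcases mul_eq_zero.mp h1 with h | h
    · exact h
    · simpa [h] using h2
  have z12 : B 1 2 = 0 := by simpa [z02] using h2.symm
  have z01 : B 0 1 = 0 := by simpa [z02] using h3
  ext i j
  fin_cases i <;> fin_cases j <;> simp [e00, e11, e22, e10, e20, e21, z01, z02, z12]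

theorem hasDerivAt_transpose_mul_self_apply {m n : Type*} [Fintype m]
    {A : ℝ → Matrix m n ℝ} {A' : Matrix m n ℝ} {τ : ℝ}
    (h : ∀ i j, HasDerivAt (fun t => A t i j) (A' i j) τ) (j k : n) :
    HasDerivAt (fun t => ((A t)ᵀ * A t) j k) ((A'ᵀ * A τ + (A τ)ᵀ * A') j k) τ := by
  simp only [mul_apply, transpose_apply, Matrix.add_apply, ← Finset.sum_add_distrib]
  exact HasDerivAt.fun_sum fun i _ => (h i j).fun_mul (h i k)

theorem transpose_mul_self_of_eq_smul {n : Type*} [Fintype n] [DecidableEq n]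
    {M : Matrix n n ℝ} (h : ∃ (l : ℝ) (O : Matrix n n ℝ), Oᵀ * O = 1 ∧ M = l • O) (i : n) :
    Mᵀ * M = (Mᵀ * M) i i • (1 : Matrix n n ℝ) := by
  obtain ⟨l, O, hO, rfl⟩ := h
  simp [hO, smul_smul]

theorem transpose_mul_self_apply_pos {n : Type*} [Fintype n] [DecidableEq n]
    {M : Matrix n n ℝ} (h : ∃ (l : ℝ) (O : Matrix n n ℝ), Oᵀ * O = 1 ∧ M = l • O)
    (hM : M ≠ 0) (i : n) : 0 < (Mᵀ * M) i i := by
  obtain ⟨l, O, hO, rfl⟩ := h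
  have hl : l ≠ 0 := by
    rintro rfl
    simp at hM
  simpa [hO] using hl

/-- If `A`, with `Aᵀ * A = g • 1` and `g ≠ 0`, and `A'` are conformal and the symmetric part of
`Aᵀ * A'` is scalar, then `A'` is a multiple of `A`. -/
theorem smul_eq_smul_of_conformal {A A' : Matrix (Fin 3) (Fin 3) ℝ} {g m s : ℝ} (hg : g ≠ 0)
    (hA : Aᵀ * A = g • (1 : Matrix (Fin 3) (Fin 3) ℝ))
    (hA' : A'ᵀ * A' = m • (1 : Matrix (Fin 3) (Fin 3) ℝ))
    (hs : A'ᵀ * A + Aᵀ * A' = s • (1 : Matrix (Fin 3) (Fin 3) ℝ)) :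
    g • A' = (s / 2) • A := by
  have hAA : A * Aᵀ = g • (1 : Matrix (Fin 3) (Fin 3) ℝ) := by
    have h1 : (g⁻¹ • Aᵀ) * A = 1 := by simp [hA, smul_smul, hg]
    have h2 : g • (A * (g⁻¹ • Aᵀ)) = g • (1 : Matrix (Fin 3) (Fin 3) ℝ) := by
      rw [mul_eq_one_comm.mp h1]
    simpa [smul_smul, hg] using h2
  have hB : Aᵀ * A' = (s / 2) • (1 : Matrix (Fin 3) (Fin 3) ℝ) := by
    refine eq_smul_one_of_add_transpose_of_transpose_mul_self (m := g * m) ?_ ?_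
    · simpa using hs
    · calc (Aᵀ * A')ᵀ * (Aᵀ * A') = A'ᵀ * (A * Aᵀ) * A' := by
            simp [Matrix.mul_assoc]
        _ = (g * m) • (1 : Matrix (Fin 3) (Fin 3) ℝ) := by
            simp [hAA, hA', smul_smul]
  calc g • A' = (A * Aᵀ) * A' := by simp [hAA]
    _ = (s / 2) • A := by simp [Matrix.mul_assoc, hB]

/-- Let `I ⊆ ℝ` be an open interval and `A : I → M₃(ℝ)` a
continuously differentiable matrix-valued function (with entrywise derivative `A'`)
such that for every `τ ∈ I` both `A(τ)` and `A'(τ)` are real scalar multiples of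
orthogonal matrices, and `A(τ) ≠ 0` for all `τ ∈ I`. Then there exist a single real
orthogonal `3×3` matrix `S` and a function `f : I → ℝ`, nowhere zero on `I`, such
that `A(τ) = f(τ)·S` for all `τ ∈ I`. -/
theorem isotropic_family_constant_direction
    (I : Set ℝ) (hIopen : IsOpen I) (hIconn : I.OrdConnected)
    (A A' : ℝ → Matrix (Fin 3) (Fin 3) ℝ)
    (hderiv : ∀ (i j : Fin 3), ∀ τ ∈ I, HasDerivAt (fun t => A t i j) (A' τ i j) τ)
    (hcont : ∀ i j : Fin 3, ContinuousOn (fun t => A' t i j) I)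
    (hA : ∀ τ ∈ I, ∃ (l : ℝ) (O : Matrix (Fin 3) (Fin 3) ℝ), Oᵀ * O = 1 ∧ A τ = l • O)
    (hA' : ∀ τ ∈ I, ∃ (l : ℝ) (O : Matrix (Fin 3) (Fin 3) ℝ), Oᵀ * O = 1 ∧ A' τ = l • O)
    (hne : ∀ τ ∈ I, A τ ≠ 0) :
    ∃ (S : Matrix (Fin 3) (Fin 3) ℝ) (f : ℝ → ℝ),
      Sᵀ * S = 1 ∧ ∀ τ ∈ I, f τ ≠ 0 ∧ A τ = f τ • S := by
  rcases I.eq_empty_or_nonempty with rfl | ⟨τ₀, hτ₀⟩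
  · exact ⟨1, 0, by simp, by simp⟩
  set g : ℝ → ℝ := fun t => ((A t)ᵀ * A t) 0 0
  have hg : ∀ τ ∈ I, (A τ)ᵀ * A τ = g τ • (1 : Matrix (Fin 3) (Fin 3) ℝ) :=
    fun τ hτ => transpose_mul_self_of_eq_smul (hA τ hτ) 0
  have hpos : ∀ τ ∈ I, 0 < g τ :=
    fun τ hτ => transpose_mul_self_apply_pos (hA τ hτ) (hne τ hτ) 0
  set s : ℝ → ℝ := fun τ => ((A' τ)ᵀ * A τ + (A τ)ᵀ * A' τ) 0 0
  have hg' : ∀ τ ∈ I, HasDerivAt g (s τ) τ := fun τ hτ =>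
    hasDerivAt_transpose_mul_self_apply (fun i j => hderiv i j τ hτ) 0 0
  have hs : ∀ τ ∈ I, (A' τ)ᵀ * A τ + (A τ)ᵀ * A' τ =
      s τ • (1 : Matrix (Fin 3) (Fin 3) ℝ) := by
    intro τ hτ
    ext j k
    refine (hasDerivAt_transpose_mul_self_apply (fun i j => hderiv i j τ hτ) j k).unique ?_
    refine ((hg' τ hτ).mul_const ((1 : Matrix (Fin 3) (Fin 3) ℝ) j k)).congr_of_eventuallyEq ?_
    filter_upwards [hIopen.mem_nhds hτ] with t ht
    simp [hg t ht]
  have hprop : ∀ τ ∈ I, g τ • A' τ = (s τ / 2) • A τ := fun τ hτ =>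
    smul_eq_smul_of_conformal (hpos τ hτ).ne' (hg τ hτ)
      (transpose_mul_self_of_eq_smul (hA' τ hτ) 0) (hs τ hτ)
  have hquot : ∀ i j, ∀ τ ∈ I, HasDerivAt (fun t => A t i j / √(g t)) 0 τ := by
    intro i j τ hτ
    have hsq := Real.sqrt_pos.mpr (hpos τ hτ)
    have hmul : g τ * A' τ i j = s τ / 2 * A τ i j := by
      simpa using congrFun (congrFun (hprop τ hτ) i) j
    refine ((hderiv i j τ hτ).fun_div ((hg' τ hτ).sqrt (hpos τ hτ).ne') hsq.ne').congr_deriv ?_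
    have h2 : √(g τ) ^ 2 = g τ := Real.sq_sqrt (hpos τ hτ).le
    rw [← h2] at hmul
    rw [div_eq_zero_iff, sub_eq_zero]
    left
    field_simp
    linarith
  have hconst : ∀ i j, ∀ τ ∈ I, A τ i j / √(g τ) = A τ₀ i j / √(g τ₀) := by
    intro i j τ hτ
    exact hIopen.is_const_of_deriv_eq_zero hIconn.isPreconnected
      (fun t ht => (hquot i j t ht).differentiableAt.differentiableWithinAt)
      (fun t ht => (hquot i j t ht).deriv) hτ hτ₀
  refine ⟨(√(g τ₀))⁻¹ • A τ₀, fun t => √(g t), ?_, fun τ hτ => ?_⟩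
  · have h0 := hpos τ₀ hτ₀
    rw [transpose_smul, smul_mul_smul_comm, hg τ₀ hτ₀, smul_smul, ← mul_inv,
      Real.mul_self_sqrt h0.le, inv_mul_cancel₀ h0.ne', one_smul]
  · have hsq := (Real.sqrt_pos.mpr (hpos τ hτ)).ne'
    refine ⟨hsq, ?_⟩
    ext i j
    have h := hconst i j τ hτ
    rw [div_eq_iff hsq] at h
    simp only [Matrix.smul_apply, smul_eq_mul]
    rw [h]
    ring
end

section
/- Let A : ℝ → M₃(ℝ) be a real-analytic matrix-valued function such that for every τ ∈ ℝ both A(τ) and A'(τ) are real scalar multiples of orthogonal matrices. Then there exist a single real orthogonal 3×3 matrix S and a function f : ℝ → ℝ such that A(τ) = f(τ)·S for all τ ∈ ℝ. -/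
open Matrix

/-- A skew-symmetric real `3 × 3` matrix whose square is scalar vanishes. -/
theorem skew_fin_three_eq_zero_of_mul_self_eq_smul_one {K : Matrix (Fin 3) (Fin 3) ℝ} {c : ℝ}
    (hK : Kᵀ = -K) (hc : K * K = c • 1) : K = 0 := by
  have s : ∀ i j, K j i = -K i j := fun i j => by
    simpa using congrFun (congrFun hK i) j
  have e : ∀ i j, K i 0 * K 0 j + K i 1 * K 1 j + K i 2 * K 2 j =
      c * (1 : Matrix (Fin 3) (Fin 3) ℝ) i j := fun i j => by
    simpa [Matrix.mul_apply, Fin.sum_univ_three] using congrFun (congrFun hc i) j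
  have d0 : K 0 0 = 0 := by linarith [s 0 0]
  have d1 : K 1 1 = 0 := by linarith [s 1 1]
  have d2 : K 2 2 = 0 := by linarith [s 2 2]
  have e00 := e 0 0
  have e11 := e 1 1
  have e22 := e 2 2
  have e01 := e 0 1
  have e02 := e 0 2
  have e12 := e 1 2
  simp [d0, d1, d2, s 0 1, s 0 2, s 1 2] at e00 e11 e22 e01 e02 e12
  have h01 : K 0 1 = 0 := by
    rcases e12 with h | h
    · exact h
    · rw [h] at e22
      nlinarith
  have h02 : K 0 2 = 0 := by
    rw [h01] at e00 e11
    rcases e01 with h | h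
    · exact h
    · rw [h] at e11
      nlinarith
  have h12 : K 1 2 = 0 := by
    rw [h01, h02] at e00
    rw [h01] at e11
    nlinarith
  ext i j
  fin_cases i <;> fin_cases j <;> simp [d0, d1, d2, h01, h02, h12, s 0 1, s 0 2, s 1 2]

/-- If `M` and `N` are real `3 × 3` conformal matrices and the symmetric part of `Mᵀ * N` is
scalar, then `N` is parallel to `M`. -/
theorem smul_eq_smul_of_conformal_fin_three {M N : Matrix (Fin 3) (Fin 3) ℝ} {q p a : ℝ}
    (hM : M * Mᵀ = q • 1) (hN : Nᵀ * N = p • 1)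
    (h : Mᵀ * N + Nᵀ * M = (2 * a) • 1) : q • N = a • M := by
  have hB : Nᵀ * M = (2 * a) • 1 - Mᵀ * N := eq_sub_of_add_eq' h
  have hBB : (Nᵀ * M) * (Mᵀ * N) = (q * p) • 1 := by
    rw [Matrix.mul_assoc, ← Matrix.mul_assoc M, hM]
    simp [hN, smul_smul]
  have hK : Mᵀ * N - a • 1 = 0 := by
    apply skew_fin_three_eq_zero_of_mul_self_eq_smul_one (c := a ^ 2 - q * p)
    · simp only [transpose_sub, transpose_mul, transpose_transpose, transpose_smul,
        transpose_one, hB]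
      module
    · rw [hB] at hBB
      simp only [sub_mul, mul_sub, smul_mul_assoc, mul_smul_comm, one_mul, mul_one] at hBB ⊢
      have hsq : (Mᵀ * N) * (Mᵀ * N) = (2 * a) • (Mᵀ * N) - (q * p) • 1 := by
        rw [← hBB]; abel
      rw [hsq]
      module
  calc q • N = M * (Mᵀ * N) := by rw [← Matrix.mul_assoc, hM]; simp
    _ = a • M := by rw [sub_eq_zero.mp hK]; simp

/-- Along a differentiable curve of conformal real `3 × 3` matrices with conformal derivative,
the derivative is parallel to the curve wherever the latter does not vanish. -/
theorem exists_deriv_eq_smul_of_conformal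
    {A A' : ℝ → Matrix (Fin 3) (Fin 3) ℝ}
    (hderiv : ∀ (i j : Fin 3) (τ : ℝ), HasDerivAt (fun t => A t i j) (A' τ i j) τ)
    (hA : ∀ τ : ℝ, ∃ (l : ℝ) (O : Matrix (Fin 3) (Fin 3) ℝ), Oᵀ * O = 1 ∧ A τ = l • O)
    (hA' : ∀ τ : ℝ, ∃ (l : ℝ) (O : Matrix (Fin 3) (Fin 3) ℝ), Oᵀ * O = 1 ∧ A' τ = l • O)
    {τ : ℝ} (hτ : A τ ≠ 0) : ∃ b : ℝ, A' τ = b • A τ := by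
  have hG : ∀ i j, HasDerivAt (fun t => ((A t)ᵀ * A t) i j)
      (((A τ)ᵀ * A' τ + (A' τ)ᵀ * A τ) i j) τ := fun i j => by
    have := HasDerivAt.fun_sum (u := Finset.univ)
      fun k (_ : k ∈ Finset.univ) => (hderiv k i τ).mul (hderiv k j τ)
    refine this.congr_deriv ?_
    rw [Matrix.add_apply, Matrix.mul_apply, Matrix.mul_apply, ← Finset.sum_add_distrib]
    exact Finset.sum_congr rfl fun k _ => by simp only [transpose_apply]; ring
  have hq : ∀ t, ∃ q : ℝ, (A t)ᵀ * A t = q • 1 := fun t => by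
    obtain ⟨l, O, hO, h⟩ := hA t
    exact ⟨l * l, by simp [h, hO, smul_smul]⟩
  have hoff : ∀ i j, i ≠ j → ((A τ)ᵀ * A' τ + (A' τ)ᵀ * A τ) i j = 0 := fun i j hij => by
    refine (hG i j).unique ((hasDerivAt_const τ (0 : ℝ)).congr_of_eventuallyEq ?_)
    refine Filter.Eventually.of_forall fun t => ?_
    obtain ⟨q, h⟩ := hq t
    simp [h, hij]
  have hdiag : ∀ i, ((A τ)ᵀ * A' τ + (A' τ)ᵀ * A τ) i i =
      ((A τ)ᵀ * A' τ + (A' τ)ᵀ * A τ) 0 0 := fun i => by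
    refine (hG i i).unique ((hG 0 0).congr_of_eventuallyEq ?_)
    refine Filter.Eventually.of_forall fun t => ?_
    obtain ⟨q, h⟩ := hq t
    simp [h]
  obtain ⟨l, O, hO, h⟩ := hA τ
  obtain ⟨m, P, hP, h'⟩ := hA' τ
  have hl : l ≠ 0 := by
    rintro rfl
    simp [h] at hτ
  set a := ((A τ)ᵀ * A' τ + (A' τ)ᵀ * A τ) 0 0 / 2 with ha
  have key : (l * l) • A' τ = a • A τ := by
    refine smul_eq_smul_of_conformal_fin_three (p := m * m) ?_ ?_ ?_
    · simp [h, mul_eq_one_comm.mp hO, smul_smul]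
    · simp [h', hP, smul_smul]
    · ext i j
      by_cases hij : i = j
      · subst hij
        rw [hdiag, ha]
        simp
        ring
      · rw [hoff i j hij]
        simp [hij]
  refine ⟨(l * l)⁻¹ * a, ?_⟩
  rw [mul_smul, ← key, inv_smul_smul₀ (mul_ne_zero hl hl)]

/-- Let `A : ℝ → M₃(ℝ)` be a real-analytic matrix-valued function
(with entrywise derivative `A'`) such that for every `τ ∈ ℝ` both `A(τ)` and `A'(τ)`
are real scalar multiples of orthogonal matrices. Then there exist a single real
orthogonal `3×3` matrix `S` and a function `f : ℝ → ℝ` such that `A(τ) = f(τ)·S`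
for all `τ ∈ ℝ`. -/
theorem analytic_isotropic_family_constant_direction
    (A A' : ℝ → Matrix (Fin 3) (Fin 3) ℝ)
    (hanalytic : ∀ (i j : Fin 3) (τ : ℝ), AnalyticAt ℝ (fun t => A t i j) τ)
    (hderiv : ∀ (i j : Fin 3) (τ : ℝ), HasDerivAt (fun t => A t i j) (A' τ i j) τ)
    (hA : ∀ τ : ℝ, ∃ (l : ℝ) (O : Matrix (Fin 3) (Fin 3) ℝ), Oᵀ * O = 1 ∧ A τ = l • O)
    (hA' : ∀ τ : ℝ, ∃ (l : ℝ) (O : Matrix (Fin 3) (Fin 3) ℝ), Oᵀ * O = 1 ∧ A' τ = l • O) :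
    ∃ (S : Matrix (Fin 3) (Fin 3) ℝ) (f : ℝ → ℝ),
      Sᵀ * S = 1 ∧ ∀ τ : ℝ, A τ = f τ • S := by
  by_cases hzero : ∀ t k l, A t k l = 0
  · exact ⟨1, 0, by simp, fun τ => by ext i j; simp [hzero]⟩
  push Not at hzero
  obtain ⟨t₀, k, l, hkl⟩ := hzero
  have hloc : ∀ i j, ∀ᶠ t in nhds t₀, A t i j * A t₀ k l = A t k l * A t₀ i j := fun i j => by
    obtain ⟨ε, hε, hball⟩ := Metric.eventually_nhds_iff_ball.mp
      ((hderiv k l t₀).continuousAt.eventually_ne hkl)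
    refine Metric.eventually_nhds_iff_ball.mpr ⟨ε, hε, fun t ht => ?_⟩
    have hd : ∀ s ∈ Metric.ball t₀ ε, HasDerivAt (fun t => A t i j / A t k l) 0 s := by
      intro s hs
      have hs0 := hball s hs
      obtain ⟨b, hb⟩ := exists_deriv_eq_smul_of_conformal hderiv hA hA' (τ := s)
        fun h0 => hs0 (by simp [h0])
      refine ((hderiv i j s).div (hderiv k l s) hs0).congr_deriv ?_
      simp only [hb, Matrix.smul_apply, smul_eq_mul]
      ring
    have hconst : A t i j / A t k l = A t₀ i j / A t₀ k l :=
      Metric.isOpen_ball.is_const_of_deriv_eq_zero (convex_ball t₀ ε).isPreconnected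
        (fun s hs => (hd s hs).differentiableAt.differentiableWithinAt)
        (fun s hs => (hd s hs).deriv) ht (Metric.mem_ball_self hε)
    rw [div_eq_div_iff (hball t ht) hkl] at hconst
    linarith
  have hglob : ∀ i j t, A t i j * A t₀ k l = A t k l * A t₀ i j := fun i j t =>
    congrFun (AnalyticOnNhd.eq_of_eventuallyEq
      (f := fun t => A t i j * A t₀ k l) (g := fun t => A t k l * A t₀ i j)
      (fun s _ => (hanalytic i j s).mul analyticAt_const)
      (fun s _ => (hanalytic k l s).mul analyticAt_const) (hloc i j)) t
  obtain ⟨r, O, hO, h⟩ := hA t₀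
  refine ⟨O, fun t => A t k l / A t₀ k l * r, hO, fun t => ?_⟩
  rw [mul_smul, ← h]
  ext i j
  rw [Matrix.smul_apply, smul_eq_mul, div_mul_eq_mul_div, eq_div_iff hkl, hglob]
end

section
/- Let I ⊆ ℝ be an open interval and A : I → M₃(ℝ) a continuously differentiable matrix-valued function such that A(τ) has rank exactly 1 for every τ ∈ I, and A'(τ) is a real scalar multiple of an orthogonal matrix for every τ ∈ I. Then A is constant on I (equivalently, A'(τ) = 0 for all τ ∈ I). -/
open Matrix

/-- A sum of two rank-one `3 × 3` matrices is singular. -/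
theorem det_fin_three_vecMulVec_add_vecMulVec {R : Type*} [CommRing R] (u v w z : Fin 3 → R) :
    (vecMulVec u v + vecMulVec w z).det = 0 := by
  simp only [det_fin_three, Matrix.add_apply, vecMulVec_apply]
  ring

/-- A rank-one matrix is the outer product of two vectors. -/
theorem exists_eq_vecMulVec_of_rank_eq_one {m n K : Type*} [Fintype n] [DecidableEq n] [Field K]
    {M : Matrix m n K} (h : M.rank = 1) : ∃ (u : m → K) (v : n → K), M = vecMulVec u v := by
  obtain ⟨u, -, hu⟩ := finrank_eq_one_iff'.1 (show Module.finrank K M.mulVecLin.range = 1 from h)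
  choose c hc using fun j => hu ⟨M.mulVecLin (Pi.single j 1), LinearMap.mem_range_self _ _⟩
  refine ⟨u, c, ?_⟩
  ext i j
  have h1 := congrFun (congrArg Subtype.val (hc j)) i
  simp only [Submodule.coe_smul, Pi.smul_apply, smul_eq_mul, mulVecLin_apply,
    mulVec_single_one, col_apply] at h1
  rw [vecMulVec_apply, mul_comm, h1]

/-- The derivative of a differentiable family of rank-one `3 × 3` matrices is singular. -/
theorem det_deriv_eq_zero_of_rank_eq_one {A : ℝ → Matrix (Fin 3) (Fin 3) ℝ}
    {B : Matrix (Fin 3) (Fin 3) ℝ} {τ : ℝ}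
    (hA : ∀ i j, HasDerivAt (fun t => A t i j) (B i j) τ)
    (hrank : ∀ᶠ t in nhds τ, (A t).rank = 1) : B.det = 0 := by
  have minor (i j k l : Fin 3) :
      B i j * A τ k l + A τ i j * B k l - (B i l * A τ k j + A τ i l * B k j) = 0 := by
    refine (((hA i j).mul (hA k l)).sub ((hA i l).mul (hA k j))).unique
      ((hasDerivAt_const τ (0 : ℝ)).congr_of_eventuallyEq ?_)
    filter_upwards [hrank] with t ht
    obtain ⟨u, v, huv⟩ := exists_eq_vecMulVec_of_rank_eq_one ht
    simp only [Pi.sub_apply, Pi.mul_apply, huv, vecMulVec_apply]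
    ring
  obtain ⟨u, v, huv⟩ := exists_eq_vecMulVec_of_rank_eq_one hrank.self_of_nhds
  have hne : A τ ≠ 0 := by
    intro h
    simpa [h] using hrank.self_of_nhds
  obtain ⟨k, l, hkl⟩ : ∃ k l, A τ k l ≠ 0 := by
    by_contra! h
    exact hne (Matrix.ext h)
  have hB : B = vecMulVec (fun i => B i l) (fun j => A τ k j / A τ k l) +
      vecMulVec (fun i => A τ i l) (fun j => (B k j - v j / v l * B k l) / A τ k l) := by
    ext i j
    have hm := minor i j k l
    simp only [huv, Matrix.add_apply, vecMulVec_apply] at hm hkl ⊢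
    have hk := left_ne_zero_of_mul hkl
    have hl := right_ne_zero_of_mul hkl
    field_simp
    linear_combination hm
  rw [hB]
  exact det_fin_three_vecMulVec_add_vecMulVec _ _ _ _

/-- Let `I ⊆ ℝ` be an open interval and `A : I → M₃(ℝ)` a
continuously differentiable matrix-valued function (with entrywise derivative `A'`)
such that `A(τ)` has rank exactly 1 for every `τ ∈ I`, and `A'(τ)` is a real scalar
multiple of an orthogonal matrix for every `τ ∈ I`. Then `A` is constant on `I`. -/
theorem rank_one_family_constant
    (I : Set ℝ) (hIopen : IsOpen I) (hIconn : I.OrdConnected)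
    (A A' : ℝ → Matrix (Fin 3) (Fin 3) ℝ)
    (hderiv : ∀ (i j : Fin 3), ∀ τ ∈ I, HasDerivAt (fun t => A t i j) (A' τ i j) τ)
    (hcont : ∀ i j : Fin 3, ContinuousOn (fun t => A' t i j) I)
    (hrank : ∀ τ ∈ I, (A τ).rank = 1)
    (hA' : ∀ τ ∈ I, ∃ (l : ℝ) (O : Matrix (Fin 3) (Fin 3) ℝ), Oᵀ * O = 1 ∧ A' τ = l • O) :
    ∀ τ₁ ∈ I, ∀ τ₂ ∈ I, A τ₁ = A τ₂ := by
  have hzero : ∀ τ ∈ I, A' τ = 0 := by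
    intro τ hτ
    obtain ⟨l, O, hO, h⟩ := hA' τ hτ
    have hdet : (A' τ).det = 0 := det_deriv_eq_zero_of_rank_eq_one (fun i j => hderiv i j τ hτ)
      (Filter.eventually_of_mem (hIopen.mem_nhds hτ) hrank)
    have hO0 : O.det ≠ 0 := det_ne_zero_of_left_inverse hO
    have hl : l = 0 := by simpa [h, hO0] using hdet
    rw [h, hl, zero_smul]
  intro τ₁ h₁ τ₂ h₂
  ext i j
  refine hIopen.is_const_of_deriv_eq_zero hIconn.isPreconnected (f := fun t => A t i j)
    (fun τ hτ => (hderiv i j τ hτ).differentiableAt.differentiableWithinAt) (fun τ hτ => ?_) h₁ h₂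
  rw [(hderiv i j τ hτ).deriv, hzero τ hτ]
  rfl
end
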